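/- arXiv:1509.06073 — 7 statements merged into one kernel-verified Lean document; each statement's English description precedes it below -/
import Mathlib

section
/- There exist universal constants c₀, C > 0 such that the following holds. Suppose μ = ν (so ρ ≡ 1 and u_i = max{1, sup_{t∈D}|φ_i(t)|}), and let w = (w_i)_{i∈I} be weights with w_i ≥ u_i for all i ∈ I. Let 0 < ε < e^{-1}, K ∈ ℕ, s ≥ 1, and x ∈ ℓ¹_w(I). If m ≥ c₀ · s · log(ε^{-1}) · log(2N√s), then with probability at least 1 − ε over the i.i.d. draw of t_1,…,t_m from μ, every minimizer x̂ of the truncated weighted ℓ¹ problem satisfies ‖x − x̂‖ ≤ C·( λ·√s·( η/√m + ‖x − P_K x‖_{1,u} ) + σ_{s,K}(x)_{1,w} + T_{K,w}(x) ), where λ := 1 + √(log(ε^{-1}))/log(2N√s) and σ_{s,K}(x)_{1,w} := min{ ‖x − P_Δ x‖_{1,w} : Δ ⊆ I_K, |Δ|_w ≤ s } is the best weighted s-sparse approximation error. -/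
open scoped BigOperators
open MeasureTheory

/-- Application of the sampling matrix `U` (here `ρ ≡ 1` since `μ = ν`), `U_{kj} = φ_j(t_k)`. -/
noncomputable def Uapp0 {D : Type*} {I : Type*} (φ : I → D → ℂ) {m : ℕ}
    (t : Fin m → D) (z : I → ℂ) (k : Fin m) : ℂ :=
  ∑' j, z j * φ j (t k)

/-- The ℓ² norm on `ℂ^m`. -/
noncomputable def l2m {m : ℕ} (y : Fin m → ℂ) : ℝ := Real.sqrt (∑ k, ‖y k‖ ^ 2)

/-- The ℓ² norm on sequences indexed by `I`. -/
noncomputable def l2I {I : Type*} (z : I → ℂ) : ℝ := Real.sqrt (∑' i, ‖z i‖ ^ 2)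

/-- The coordinate projection `P_S` onto a finite index set `S`. -/
def proj {I : Type*} [DecidableEq I] (S : Finset I) (z : I → ℂ) : I → ℂ :=
  fun i => if i ∈ S then z i else 0

/-- Feed the samples `t 0, t 1, …` one after the other to the state update `f`. -/
def iterRun {D E : Type*} (f : E → D → E) : (m : ℕ) → (Fin m → D) → E → E
  | 0, _, z => z
  | m + 1, t, z => iterRun f m (Fin.tail t) (f z (t 0))

theorem measurable_iterRun {D E : Type*} [MeasurableSpace D] [MeasurableSpace E]
    {f : E → D → E} (hf : Measurable (Function.uncurry f)) (m : ℕ) :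
    Measurable (fun p : (Fin m → D) × E => iterRun f m p.1 p.2) := by
  induction m with
  | zero => exact measurable_snd
  | succ m ih =>
    have h : Measurable fun p : (Fin (m + 1) → D) × E =>
        ((Fin.tail p.1 : Fin m → D), f p.2 (p.1 0)) := by
      refine Measurable.prodMk ?_ ?_
      · exact measurable_pi_lambda _ fun i => (measurable_pi_apply _).comp measurable_fst
      · exact hf.comp (measurable_snd.prodMk ((measurable_pi_apply 0).comp measurable_fst))
    exact ih.comp h

theorem lintegral_pi_fin_succ {D : Type*} [MeasurableSpace D] (μ : Measure D)
    [IsProbabilityMeasure μ] (m : ℕ) {F : (Fin (m + 1) → D) → ENNReal} (hF : Measurable F) :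
    ∫⁻ t, F t ∂(Measure.pi fun _ : Fin (m + 1) => μ) =
      ∫⁻ d, ∫⁻ t, F (Fin.cons d t) ∂(Measure.pi fun _ : Fin m => μ) ∂μ := by
  have h := (measurePreserving_piFinSuccAbove (fun _ : Fin (m + 1) => μ) 0).symm
  rw [← h.lintegral_comp hF]
  refine (lintegral_prod _ (hF.comp h.measurable).aemeasurable).trans ?_
  simp [MeasurableEquiv.piFinSuccAbove, Fin.insertNthEquiv]

/-- A potential that contracts by `c` in mean at every step contracts by `c ^ m` over `m`
independent samples. -/
theorem lintegral_iterRun_le {D E : Type*} [MeasurableSpace D] [MeasurableSpace E]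
    (μ : Measure D) [IsProbabilityMeasure μ] {f : E → D → E}
    (hf : Measurable (Function.uncurry f)) {V : E → ENNReal} (hV : Measurable V) (c : ENNReal)
    (hstep : ∀ z, ∫⁻ d, V (f z d) ∂μ ≤ c * V z) (m : ℕ) (z : E) :
    ∫⁻ t, V (iterRun f m t z) ∂(Measure.pi fun _ : Fin m => μ) ≤ c ^ m * V z := by
  induction m generalizing z with
  | zero => simp [iterRun]
  | succ m ih =>
    rw [lintegral_pi_fin_succ]
    · calc _ ≤ ∫⁻ d, c ^ m * V (f z d) ∂μ := lintegral_mono fun d => by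
            simpa [iterRun] using ih (f z d)
        _ = c ^ m * ∫⁻ d, V (f z d) ∂μ := by
            rw [lintegral_const_mul]
            exact hV.comp (hf.comp (measurable_const.prodMk measurable_id))
        _ ≤ c ^ m * (c * V z) := by gcongr; exact hstep z
        _ = _ := by ring
    · exact hV.comp ((measurable_iterRun hf _).comp (measurable_id.prodMk measurable_const))

/-- Markov's inequality for the final state of an iteration with a contracting potential. -/
theorem measure_iterRun_ge_le {D E : Type*} [MeasurableSpace D] [MeasurableSpace E]
    (μ : Measure D) [IsProbabilityMeasure μ] {f : E → D → E}
    (hf : Measurable (Function.uncurry f)) {V : E → ℝ} (hV : Measurable V) (hV0 : ∀ z, 0 ≤ V z)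
    {c : ℝ} (hc : 0 ≤ c) {G : E → D → ℝ} (hG : ∀ z d, V (f z d) ≤ G z d)
    (hGi : ∀ z, Integrable (G z) μ) (hGc : ∀ z, ∫ d, G z d ∂μ ≤ c * V z) (m : ℕ) (z : E)
    {b : ℝ} (hb : 0 < b) :
    (Measure.pi fun _ : Fin m => μ) {t | b ≤ V (iterRun f m t z)} ≤
      ENNReal.ofReal (c ^ m * V z / b) := by
  have hstep : ∀ z, ∫⁻ d, ENNReal.ofReal (V (f z d)) ∂μ ≤
      ENNReal.ofReal c * ENNReal.ofReal (V z) := by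
    intro z
    rw [← ENNReal.ofReal_mul hc]
    calc _ ≤ ∫⁻ d, ENNReal.ofReal (G z d) ∂μ :=
          lintegral_mono fun d => ENNReal.ofReal_le_ofReal (hG z d)
      _ = ENNReal.ofReal (∫ d, G z d ∂μ) :=
          (ofReal_integral_eq_lintegral_ofReal (hGi z)
            (Filter.Eventually.of_forall fun d => (hV0 _).trans (hG z d))).symm
      _ ≤ _ := ENNReal.ofReal_le_ofReal (hGc z)
  have h1 := lintegral_iterRun_le μ hf hV.ennreal_ofReal _ hstep m z
  have hmeas : Measurable fun t : Fin m → D => ENNReal.ofReal (V (iterRun f m t z)) :=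
    hV.ennreal_ofReal.comp
      ((measurable_iterRun hf _).comp (measurable_id.prodMk measurable_const))
  have h2 := mul_meas_ge_le_lintegral (μ := Measure.pi fun _ : Fin m => μ) hmeas
    (ENNReal.ofReal b)
  have h3 : {t : Fin m → D | b ≤ V (iterRun f m t z)} ⊆
      {t | ENNReal.ofReal b ≤ ENNReal.ofReal (V (iterRun f m t z))} :=
    fun t ht => ENNReal.ofReal_le_ofReal ht
  refine (measure_mono h3).trans ?_
  rw [ENNReal.ofReal_div_of_pos hb, ENNReal.le_div_iff_mul_le (by simp [hb]) (by simp), mul_comm,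
    ENNReal.ofReal_mul (by positivity), ENNReal.ofReal_pow hc]
  exact h2.trans h1

section RelaxStep

variable {E : Type*} [NormedAddCommGroup E]

/-- The step size of the relaxed Kaczmarz iteration. -/
noncomputable def relaxStep (s κ : ℝ) (z : E) : ℝ := (s + Real.sqrt s * κ * ‖z‖)⁻¹

theorem relaxStep_nonneg {s κ : ℝ} (hs : 0 < s) (hκ : 0 < κ) (z : E) : 0 ≤ relaxStep s κ z := by
  unfold relaxStep; positivity

theorem relaxStep_mul_le_one {s κ : ℝ} (hs : 0 < s) (hκ : 0 < κ) (z : E) :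
    relaxStep s κ z * s ≤ 1 := by
  unfold relaxStep
  rw [inv_mul_le_iff₀ (by positivity), mul_one]
  have : 0 ≤ Real.sqrt s * κ * ‖z‖ := by positivity
  linarith

theorem relaxStep_mul_norm_le {s κ : ℝ} (hs : 0 < s) (hκ : 0 < κ) (z : E) :
    relaxStep s κ z * ‖z‖ * (Real.sqrt s * κ) ≤ 1 := by
  unfold relaxStep
  rw [mul_assoc, inv_mul_le_iff₀ (by positivity), mul_one]
  linarith

theorem measurable_relaxStep [MeasurableSpace E] [BorelSpace E] (s κ : ℝ) :
    Measurable (relaxStep s κ : E → ℝ) := by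
  unfold relaxStep; fun_prop

end RelaxStep

section Kaczmarz

variable {E : Type*} [NormedAddCommGroup E] [InnerProductSpace ℂ E]

/-- One relaxed Kaczmarz step towards the hyperplane orthogonal to `a`. -/
noncomputable def kaczmarzStep (s κ : ℝ) (z a : E) : E :=
  z - ((relaxStep s κ z : ℂ) * inner ℂ a z) • a

theorem norm_sub_inner_smul_sq_le {γ s : ℝ} (hγ : 0 ≤ γ) (hγs : γ * s ≤ 1) (z a : E)
    (ha : ‖a‖ ^ 2 ≤ s) :
    ‖z - ((γ : ℂ) * inner ℂ a z) • a‖ ^ 2 ≤ ‖z‖ ^ 2 - γ * ‖inner ℂ a z‖ ^ 2 := by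
  have h1 : RCLike.re (inner ℂ z (((γ : ℂ) * inner ℂ a z) • a)) = γ * ‖inner ℂ a z‖ ^ 2 := by
    rw [inner_smul_right, mul_assoc, ← inner_conj_symm z a, Complex.mul_conj,
      Complex.normSq_eq_norm_sq]
    norm_cast
  have h2 : ‖((γ : ℂ) * inner ℂ a z) • a‖ ^ 2 = γ * (γ * ‖a‖ ^ 2) * ‖inner ℂ a z‖ ^ 2 := by
    rw [norm_smul, norm_mul, Complex.norm_real, Real.norm_eq_abs, abs_of_nonneg hγ]
    ring
  rw [@norm_sub_sq ℂ, h1, h2]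
  have h3 : γ * ‖a‖ ^ 2 ≤ 1 := (mul_le_mul_of_nonneg_left ha hγ).trans hγs
  have h4 : γ * (γ * ‖a‖ ^ 2) * ‖inner ℂ a z‖ ^ 2 ≤ γ * 1 * ‖inner ℂ a z‖ ^ 2 := by gcongr
  linarith

theorem norm_kaczmarzStep_le {s κ : ℝ} (hs : 0 < s) (hκ : 0 < κ) (z a : E) (ha : ‖a‖ ^ 2 ≤ s) :
    ‖kaczmarzStep s κ z a‖ ≤ ‖z‖ := by
  have h := norm_sub_inner_smul_sq_le (relaxStep_nonneg hs hκ z) (relaxStep_mul_le_one hs hκ z)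
    z a ha
  have h0 := relaxStep_nonneg hs hκ z
  refine le_of_sq_le_sq ?_ (norm_nonneg _)
  exact h.trans (by nlinarith [mul_nonneg h0 (sq_nonneg ‖inner ℂ a z‖)])

theorem relaxStep_mul_inner_sq_le {s κ : ℝ} (hs : 0 < s) (hκ : 0 < κ) (z a : E)
    (ha : ‖a‖ ^ 2 ≤ s) :
    relaxStep s κ z * ‖inner ℂ a z‖ ^ 2 ≤ 2 * ‖z‖ * (‖z‖ - ‖kaczmarzStep s κ z a‖) := by
  have h := norm_sub_inner_smul_sq_le (relaxStep_nonneg hs hκ z) (relaxStep_mul_le_one hs hκ z)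
    z a ha
  have h1 := norm_kaczmarzStep_le hs hκ z a ha
  change ‖kaczmarzStep s κ z a‖ ^ 2 ≤ _ at h
  nlinarith [sq_nonneg (‖z‖ - ‖kaczmarzStep s κ z a‖)]

theorem relaxStep_sq_mul_inner_sq_le {s κ : ℝ} (hs : 0 < s) (hκ : 0 < κ) (z a : E)
    (ha : ‖a‖ ^ 2 ≤ s) :
    (relaxStep s κ z * ‖inner ℂ a z‖) ^ 2 ≤
      2 / (Real.sqrt s * κ) * (‖z‖ - ‖kaczmarzStep s κ z a‖) := by
  have h1 := relaxStep_mul_inner_sq_le hs hκ z a ha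
  have h2 := relaxStep_mul_norm_le hs hκ z
  have h3 := norm_kaczmarzStep_le hs hκ z a ha
  have hp : 0 < Real.sqrt s * κ := by positivity
  have h0 := relaxStep_nonneg hs hκ z
  have h4 : relaxStep s κ z * ‖z‖ ≤ 1 / (Real.sqrt s * κ) := by
    rwa [le_div_iff₀ hp]
  calc _ = relaxStep s κ z * (relaxStep s κ z * ‖inner ℂ a z‖ ^ 2) := by ring
    _ ≤ relaxStep s κ z * (2 * ‖z‖ * (‖z‖ - ‖kaczmarzStep s κ z a‖)) := by gcongr
    _ = (relaxStep s κ z * ‖z‖) * (2 * (‖z‖ - ‖kaczmarzStep s κ z a‖)) := by ring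
    _ ≤ 1 / (Real.sqrt s * κ) * (2 * (‖z‖ - ‖kaczmarzStep s κ z a‖)) := by
        gcongr
    _ = _ := by ring

theorem relaxStep_mul_inner_le {s κ : ℝ} (hs : 0 < s) (hκ : 0 < κ) (z a : E)
    (ha : ‖a‖ ^ 2 ≤ s) : relaxStep s κ z * ‖inner ℂ a z‖ ≤ 1 / κ := by
  have h2 := relaxStep_mul_norm_le hs hκ z
  have h0 := relaxStep_nonneg hs hκ z
  have ha' : ‖a‖ ≤ Real.sqrt s := Real.le_sqrt_of_sq_le ha
  rw [le_div_iff₀ hκ]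
  calc _ ≤ relaxStep s κ z * (‖a‖ * ‖z‖) * κ := by gcongr; exact norm_inner_le_norm _ _
    _ ≤ relaxStep s κ z * (Real.sqrt s * ‖z‖) * κ := by gcongr
    _ ≤ 1 := by linarith

/-- The weights with which the samples enter the Kaczmarz iteration. -/
noncomputable def kaczmarzCoeff {D : Type*} (s κ : ℝ) (a : D → E) :
    (m : ℕ) → (Fin m → D) → E → Fin m → ℂ
  | 0, _, _ => Fin.elim0
  | m + 1, t, z => Fin.cons ((relaxStep s κ z : ℂ) * inner ℂ (a (t 0)) z)
      (kaczmarzCoeff s κ a m (Fin.tail t) (kaczmarzStep s κ z (a (t 0))))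

/-- The state update of the Kaczmarz iteration driven by the samples `a`. -/
noncomputable def kaczmarzUpdate {D : Type*} (s κ : ℝ) (a : D → E) (z : E) (d : D) : E :=
  kaczmarzStep s κ z (a d)

theorem sub_iterRun_kaczmarz {D : Type*} (s κ : ℝ) (a : D → E) (m : ℕ) (t : Fin m → D) (z : E) :
    z - iterRun (kaczmarzUpdate s κ a) m t z = ∑ k, kaczmarzCoeff s κ a m t z k • a (t k) := by
  induction m generalizing z with
  | zero => simp [iterRun]
  | succ m ih =>
    have h := ih (Fin.tail t) (kaczmarzStep s κ z (a (t 0)))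
    rw [Fin.sum_univ_succ]
    simp only [kaczmarzCoeff, Fin.cons_zero, Fin.cons_succ, iterRun]
    simp only [Fin.tail] at h ⊢
    rw [← h]
    simp only [kaczmarzUpdate, kaczmarzStep]
    abel

theorem sum_kaczmarzCoeff_sq_le {D : Type*} {s κ : ℝ} (hs : 0 < s) (hκ : 0 < κ) {a : D → E}
    (ha : ∀ d, ‖a d‖ ^ 2 ≤ s) (m : ℕ) (t : Fin m → D) (z : E) :
    ∑ k, ‖kaczmarzCoeff s κ a m t z k‖ ^ 2 ≤ 2 / (Real.sqrt s * κ) * ‖z‖ := by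
  suffices h : ∑ k, ‖kaczmarzCoeff s κ a m t z k‖ ^ 2 ≤
      2 / (Real.sqrt s * κ) * (‖z‖ - ‖iterRun (kaczmarzUpdate s κ a) m t z‖) by
    refine h.trans ?_
    gcongr
    linarith [norm_nonneg (iterRun (kaczmarzUpdate s κ a) m t z)]
  induction m generalizing z with
  | zero => simp [iterRun]
  | succ m ih =>
    have h := ih (Fin.tail t) (kaczmarzStep s κ z (a (t 0)))
    have h1 := relaxStep_sq_mul_inner_sq_le hs hκ z (a (t 0)) (ha _)
    rw [Fin.sum_univ_succ]
    simp only [kaczmarzCoeff, Fin.cons_zero, Fin.cons_succ, iterRun]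
    rw [norm_mul, Complex.norm_real, Real.norm_eq_abs, abs_of_nonneg (relaxStep_nonneg hs hκ z)]
    simp only [kaczmarzUpdate] at h ⊢
    refine (add_le_add h1 h).trans (le_of_eq ?_)
    ring

/-- The Kaczmarz update together with a running correlation against `c`. -/
noncomputable def kaczmarzPairUpdate {D : Type*} (s κ : ℝ) (a : D → E) (c : D → ℂ) (p : E × ℝ)
    (d : D) : E × ℝ :=
  (kaczmarzUpdate s κ a p.1 d, p.2 + (((relaxStep s κ p.1 : ℂ) * inner ℂ (a d) p.1) * c d).re)

theorem iterRun_kaczmarzPair_snd {D : Type*} (s κ : ℝ) (a : D → E) (c : D → ℂ) (m : ℕ)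
    (t : Fin m → D) (p : E × ℝ) :
    (iterRun (kaczmarzPairUpdate s κ a c) m t p).2 =
      p.2 + ∑ k, (kaczmarzCoeff s κ a m t p.1 k * c (t k)).re := by
  induction m generalizing p with
  | zero => simp [iterRun]
  | succ m ih =>
    rw [Fin.sum_univ_succ]
    simp only [kaczmarzCoeff, Fin.cons_zero, Fin.cons_succ, iterRun, ih]
    simp only [kaczmarzPairUpdate, kaczmarzUpdate, Fin.tail]
    ring

theorem exp_sub_two_mul_sq_le {y : ℝ} (hy : |y| ≤ 1 / 2) : Real.exp (y - 2 * y ^ 2) ≤ 1 + y := by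
  obtain ⟨h1, h2⟩ := abs_le.1 hy
  have hp : 0 < 1 + y := by linarith
  rw [← Real.le_log_iff_exp_le hp]
  refine le_trans ?_ (Real.one_sub_inv_le_log_of_pos hp)
  rw [show 1 - (1 + y)⁻¹ = y / (1 + y) by field_simp; ring, le_div_iff₀ hp]
  nlinarith [mul_nonneg (sq_nonneg y) (show (0:ℝ) ≤ 1 + 2 * y by linarith)]

variable [MeasurableSpace E] [BorelSpace E] [SecondCountableTopology E]
  {D : Type*} [MeasurableSpace D]

theorem measurable_kaczmarzUpdate (s κ : ℝ) {a : D → E} (ha : Measurable a) :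
    Measurable (Function.uncurry (kaczmarzUpdate s κ a)) := by
  have h1 : Measurable fun p : E × D => relaxStep s κ p.1 :=
    (measurable_relaxStep s κ).comp measurable_fst
  have h2 : Measurable fun p : E × D => a p.2 := ha.comp measurable_snd
  have h3 : Measurable fun p : E × D => inner ℂ (a p.2) p.1 := h2.inner measurable_fst
  exact measurable_fst.sub (((Complex.measurable_ofReal.comp h1).mul h3).smul h2)

theorem measurable_kaczmarzPairUpdate (s κ : ℝ) {a : D → E} (ha : Measurable a) {c : D → ℂ}
    (hc : Measurable c) : Measurable (Function.uncurry (kaczmarzPairUpdate s κ a c)) := by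
  have h1 : Measurable fun p : (E × ℝ) × D => relaxStep s κ p.1.1 :=
    (measurable_relaxStep s κ).comp (measurable_fst.comp measurable_fst)
  have h2 : Measurable fun p : (E × ℝ) × D => inner ℂ (a p.2) p.1.1 :=
    (ha.comp measurable_snd).inner (measurable_fst.comp measurable_fst)
  have h3 : Measurable fun p : (E × ℝ) × D => c p.2 := hc.comp measurable_snd
  refine Measurable.prodMk ?_ ?_
  · exact (measurable_kaczmarzUpdate s κ ha).comp
      ((measurable_fst.comp measurable_fst).prodMk measurable_snd)
  · exact (measurable_snd.comp measurable_fst).add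
      (Complex.measurable_re.comp (((Complex.measurable_ofReal.comp h1).mul h2).mul h3))

theorem integrable_inner_sq {s : ℝ} {a : D → E} (ham : Measurable a) (ha : ∀ d, ‖a d‖ ^ 2 ≤ s)
    (μ : Measure D) [IsProbabilityMeasure μ] (z : E) :
    Integrable (fun d => ‖inner ℂ (a d) z‖ ^ 2) μ := by
  refine Integrable.of_bound ((ham.inner_const).norm.pow_const 2).aestronglyMeasurable
    (s * ‖z‖ ^ 2) (Filter.Eventually.of_forall fun d => ?_)
  rw [Real.norm_eq_abs, abs_of_nonneg (by positivity)]
  calc _ ≤ (‖a d‖ * ‖z‖) ^ 2 := by gcongr; exact norm_inner_le_norm _ _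
    _ = ‖a d‖ ^ 2 * ‖z‖ ^ 2 := by ring
    _ ≤ _ := by gcongr; exact ha d

/-- For isotropic samples the Kaczmarz iteration contracts the starting vector with high
probability. -/
theorem measure_kaczmarz_norm_ge_le {s κ : ℝ} (hs : 1 ≤ s) (hκ : 0 < κ) {a : D → E}
    (ham : Measurable a) (ha : ∀ d, ‖a d‖ ^ 2 ≤ s) (μ : Measure D) [IsProbabilityMeasure μ]
    (hiso : ∀ z, ∫ d, ‖inner ℂ (a d) z‖ ^ 2 ∂μ = ‖z‖ ^ 2) (m : ℕ) (z : E) {β : ℝ} (hβ : 0 < β) :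
    (Measure.pi fun _ : Fin m => μ) {t | β ≤ ‖iterRun (kaczmarzUpdate s κ a) m t z‖} ≤
      ENNReal.ofReal
        ((1 - 1 / (4 * s)) ^ m * (‖z‖ * Real.exp (κ / Real.sqrt s * ‖z‖)) / β) := by
  have hs0 : 0 < s := by linarith
  have hr : 0 < Real.sqrt s := Real.sqrt_pos.2 hs0
  have hrr : Real.sqrt s * Real.sqrt s = s := Real.mul_self_sqrt hs0.le
  have h14 : 1 / (4 * s) ≤ 1 := by rw [div_le_one (by positivity)]; linarith
  have key : ∀ z d, ‖kaczmarzUpdate s κ a z d‖ *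
      Real.exp (κ / Real.sqrt s * ‖kaczmarzUpdate s κ a z d‖) ≤
      ‖z‖ * Real.exp (κ / Real.sqrt s * ‖z‖) *
        (1 - 1 / (4 * s * ‖z‖ ^ 2) * ‖inner ℂ (a d) z‖ ^ 2) := by
    intro z d
    have hle := norm_kaczmarzStep_le hs0 hκ z (a d) (ha d)
    have hsq := relaxStep_mul_inner_sq_le hs0 hκ z (a d) (ha d)
    change ‖kaczmarzUpdate s κ a z d‖ ≤ _ at hle
    change _ ≤ 2 * ‖z‖ * (‖z‖ - ‖kaczmarzUpdate s κ a z d‖) at hsq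
    set r' := ‖kaczmarzUpdate s κ a z d‖
    rcases (norm_nonneg z).eq_or_lt with h0 | h0
    · have : r' = 0 := le_antisymm (h0 ▸ hle) (norm_nonneg _)
      simp [this, ← h0]
    set r := ‖z‖ with hrdef
    set B := ‖inner ℂ (a d) z‖ ^ 2 with hB
    have hB0 : 0 ≤ B := by positivity
    have hBle : B ≤ s * r ^ 2 := by
      calc B ≤ (‖a d‖ * ‖z‖) ^ 2 := by rw [hB]; gcongr; exact norm_inner_le_norm _ _
        _ = ‖a d‖ ^ 2 * r ^ 2 := by ring
        _ ≤ _ := by gcongr; exact ha d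
    set δ := B / (2 * s * r ^ 2) with hδ
    have hδ0 : 0 ≤ δ := by positivity
    have hδ1 : δ ≤ 1 / 2 := by
      rw [hδ, div_le_iff₀ (by positivity)]; linarith
    have hpos : 0 < s + Real.sqrt s * κ * r := by positivity
    have hdec : δ ≤ (κ / Real.sqrt s + 1 / r) * (r - r') := by
      have h1 : B / (s + Real.sqrt s * κ * r) ≤ 2 * r * (r - r') := by
        rw [div_eq_inv_mul]; exact hsq
      rw [div_le_iff₀ hpos] at h1
      rw [hδ, div_le_iff₀ (by positivity)]
      calc B ≤ _ := h1
        _ = _ := by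
          have e1 : κ / Real.sqrt s * s = κ * Real.sqrt s := by
            rw [div_mul_eq_mul_div, div_eq_iff hr.ne', mul_assoc, hrr]
          have e2 : 1 / r * r = 1 := one_div_mul_cancel h0.ne'
          linear_combination (-2 * r ^ 2 * (r - r')) * e1 - 2 * s * r * (r - r') * e2
    have hrle : r' ≤ r * Real.exp (-(1 / r * (r - r'))) := by
      have := Real.add_one_le_exp (-(1 / r * (r - r')))
      calc r' = r * (-(1 / r * (r - r')) + 1) := by field_simp; ring
        _ ≤ _ := by gcongr
    have hexp : Real.exp (-δ) ≤ 1 - δ / 2 := by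
      have h1 : Real.exp (-δ) ≤ (1 + δ)⁻¹ := by
        rw [Real.exp_neg]
        gcongr
        linarith [Real.add_one_le_exp δ]
      refine h1.trans ?_
      rw [inv_le_iff_one_le_mul₀ (by positivity)]
      nlinarith
    calc r' * Real.exp (κ / Real.sqrt s * r')
        ≤ r * Real.exp (-(1 / r * (r - r'))) * Real.exp (κ / Real.sqrt s * r') := by gcongr
      _ = r * Real.exp (κ / Real.sqrt s * r) *
          Real.exp (-((κ / Real.sqrt s + 1 / r) * (r - r'))) := by
        rw [mul_assoc, mul_assoc, ← Real.exp_add, ← Real.exp_add]; ring_nf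
      _ ≤ r * Real.exp (κ / Real.sqrt s * r) * (1 - δ / 2) := by
        gcongr
        exact (Real.exp_le_exp.2 (by linarith)).trans hexp
      _ = _ := by rw [hδ]; ring
  have hmain := measure_iterRun_ge_le μ (measurable_kaczmarzUpdate s κ ham)
    (V := fun z => ‖z‖ * Real.exp (κ / Real.sqrt s * ‖z‖)) (by fun_prop) (fun z => by positivity)
    (c := 1 - 1 / (4 * s)) (by linarith) key
    (fun z => ((integrable_const _).sub ((integrable_inner_sq ham ha μ z).const_mul _)).const_mul _)
    (fun z => by
      rw [integral_const_mul, integral_sub (integrable_const _)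
        ((integrable_inner_sq ham ha μ z).const_mul _), integral_const_mul, hiso]
      rcases (norm_nonneg z).eq_or_lt with h0 | h0
      · simp [← h0]
      · apply le_of_eq
        simp only [integral_const, probReal_univ, smul_eq_mul]
        field_simp) m z hβ
  refine (measure_mono fun t ht => ?_).trans hmain
  refine le_trans (show β ≤ _ from ht) ?_
  refine le_mul_of_one_le_right (norm_nonneg _) (Real.one_le_exp (by positivity))

/-- The combination of the samples built by the Kaczmarz iteration is weakly correlated with any
bounded function orthogonal to the samples. -/
theorem measure_kaczmarz_corr_ge_le {s κ : ℝ} (hs : 1 ≤ s) (hκ : 0 < κ) {a : D → E}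
    (ham : Measurable a) (ha : ∀ d, ‖a d‖ ^ 2 ≤ s) (μ : Measure D) [IsProbabilityMeasure μ]
    {c : D → ℂ} (hcm : Measurable c) (hc : ∀ d, ‖c d‖ ≤ 1)
    (horth : ∀ z, ∫ d, inner ℂ (a d) z * c d ∂μ = 0) (m : ℕ) (z : E) (hz : ‖z‖ ≤ Real.sqrt s) :
    (Measure.pi fun _ : Fin m => μ)
        {t | 1 / 3 ≤ ∑ k, (kaczmarzCoeff s κ a m t z k * c (t k)).re} ≤
      ENNReal.ofReal (Real.exp (-(κ / 144))) := by
  have hs0 : 0 < s := by linarith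
  have hr : 0 < Real.sqrt s := Real.sqrt_pos.2 hs0
  set θ := κ / 24 with hθ
  have hθ0 : 0 < θ := by positivity
  set X : E × ℝ → D → ℝ := fun p d =>
    (((relaxStep s κ p.1 : ℂ) * inner ℂ (a d) p.1) * c d).re with hX
  have hXle : ∀ p d, |X p d| ≤ relaxStep s κ p.1 * ‖inner ℂ (a d) p.1‖ := by
    intro p d
    refine (Complex.abs_re_le_norm _).trans ?_
    rw [norm_mul, norm_mul, Complex.norm_real, Real.norm_eq_abs,
      abs_of_nonneg (relaxStep_nonneg hs0 hκ _)]
    exact mul_le_of_le_one_right (mul_nonneg (relaxStep_nonneg hs0 hκ _) (norm_nonneg _)) (hc d)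
  have hXκ : ∀ p d, |X p d| ≤ 1 / κ := fun p d =>
    (hXle p d).trans (relaxStep_mul_inner_le hs0 hκ _ _ (ha d))
  set g := κ / (144 * Real.sqrt s) with hg
  have hXm : ∀ p, Measurable (X p) := fun p =>
    Complex.measurable_re.comp (((ham.inner_const).const_mul _).mul hcm)
  have hXi : ∀ p, Integrable (X p) μ := fun p =>
    Integrable.of_bound (hXm p).aestronglyMeasurable (1 / κ)
      (Filter.Eventually.of_forall fun d => hXκ p d)
  have hX0 : ∀ p, ∫ d, X p d ∂μ = 0 := by
    intro p
    have hi : Integrable (fun d => ((relaxStep s κ p.1 : ℂ) * inner ℂ (a d) p.1) * c d) μ := by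
      refine Integrable.of_bound
        (((ham.inner_const).const_mul _).mul hcm).aestronglyMeasurable (1 / κ)
        (Filter.Eventually.of_forall fun d => ?_)
      rw [norm_mul, norm_mul, Complex.norm_real, Real.norm_eq_abs,
        abs_of_nonneg (relaxStep_nonneg hs0 hκ _)]
      exact (mul_le_of_le_one_right
        (mul_nonneg (relaxStep_nonneg hs0 hκ _) (norm_nonneg _)) (hc d)).trans
        (relaxStep_mul_inner_le hs0 hκ _ _ (ha d))
    have h := integral_re hi
    simp only [RCLike.re_to_complex] at h
    rw [hX]
    simp only
    rw [h]
    simp_rw [mul_assoc]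
    rw [integral_const_mul, horth]
    simp
  have key : ∀ p d, Real.exp (θ * (kaczmarzPairUpdate s κ a c p d).2 +
      g * ‖(kaczmarzPairUpdate s κ a c p d).1‖) ≤
      Real.exp (θ * p.2 + g * ‖p.1‖) * (1 + θ * X p d) := by
    intro p d
    have h1 : |θ * X p d| ≤ 1 / 2 := by
      rw [abs_mul, abs_of_pos hθ0]
      calc θ * |X p d| ≤ θ * (1 / κ) := by gcongr; exact hXκ p d
        _ ≤ 1 / 2 := by rw [hθ]; field_simp; norm_num
    have h2 : 2 * (θ * X p d) ^ 2 ≤ g * (‖p.1‖ - ‖kaczmarzUpdate s κ a p.1 d‖) := by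
      have h3 := relaxStep_sq_mul_inner_sq_le hs0 hκ p.1 (a d) (ha d)
      have h4 : X p d ^ 2 ≤ (relaxStep s κ p.1 * ‖inner ℂ (a d) p.1‖) ^ 2 := by
        rw [← sq_abs]; gcongr; exact hXle p d
      calc 2 * (θ * X p d) ^ 2 = 2 * θ ^ 2 * X p d ^ 2 := by ring
        _ ≤ 2 * θ ^ 2 * (2 / (Real.sqrt s * κ) * (‖p.1‖ - ‖kaczmarzStep s κ p.1 (a d)‖)) := by
          gcongr; exact h4.trans h3
        _ = _ := by rw [hθ, hg, kaczmarzUpdate]; field_simp; ring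
    calc _ = Real.exp (θ * p.2 + g * ‖p.1‖) *
          Real.exp (θ * X p d - g * (‖p.1‖ - ‖kaczmarzUpdate s κ a p.1 d‖)) := by
          rw [← Real.exp_add]; simp only [kaczmarzPairUpdate, hX]; ring_nf
      _ ≤ Real.exp (θ * p.2 + g * ‖p.1‖) * Real.exp (θ * X p d - 2 * (θ * X p d) ^ 2) := by
          gcongr
      _ ≤ _ := by gcongr; exact exp_sub_two_mul_sq_le h1
  have hmain := measure_iterRun_ge_le μ (measurable_kaczmarzPairUpdate s κ ham hcm)
    (V := fun p => Real.exp (θ * p.2 + g * ‖p.1‖)) (by fun_prop) (fun p => by positivity)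
    (c := 1) zero_le_one key
    (fun p => ((integrable_const _).add ((hXi p).const_mul _)).const_mul _)
    (fun p => by
      rw [integral_const_mul, integral_add (integrable_const _) ((hXi p).const_mul _),
        integral_const_mul, hX0]
      simp) m (z, 0) (b := Real.exp (θ / 3)) (by positivity)
  refine (measure_mono fun t ht => ?_).trans (hmain.trans (ENNReal.ofReal_le_ofReal ?_))
  · simp only [Set.mem_ofPred_eq, iterRun_kaczmarzPair_snd] at ht ⊢
    gcongr
    have : 0 ≤ g * ‖(iterRun (kaczmarzPairUpdate s κ a c) m t (z, 0)).1‖ := by positivity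
    nlinarith
  · rw [one_pow, one_mul, ← Real.exp_sub]
    gcongr
    have : g * ‖z‖ ≤ κ / 144 := by
      calc g * ‖z‖ ≤ g * Real.sqrt s := by gcongr
        _ = _ := by rw [hg]; field_simp
    simp only [mul_zero, zero_add]
    rw [hθ]
    linarith

end Kaczmarz

section TracePower

open Matrix
open scoped ComplexOrder

variable {n : Type*} [DecidableEq n]

/-- `I - γ a aᴴ`. -/
noncomputable def rankOneDown (γ : ℝ) (a : n → ℂ) : Matrix n n ℂ :=
  1 - (γ : ℂ) • vecMulVec a (star a)

theorem isHermitian_rankOneDown (γ : ℝ) (a : n → ℂ) : (rankOneDown γ a).IsHermitian := by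
  unfold rankOneDown IsHermitian
  rw [conjTranspose_sub, conjTranspose_one, conjTranspose_smul, conjTranspose_vecMulVec]
  simp

variable [Fintype n]

theorem trace_mul_pow_comm (A B : Matrix n n ℂ) (k : ℕ) :
    ((A * B) ^ k).trace = ((B * A) ^ k).trace := by
  cases k with
  | zero => simp
  | succ k =>
    have h : A * (B * A) ^ k = (A * B) ^ k * A := by
      induction k with
      | zero => simp
      | succ k ih => rw [pow_succ, ← mul_assoc, ih, pow_succ]; simp only [mul_assoc]
    rw [pow_succ, ← mul_assoc, ← h, trace_mul_comm, ← mul_assoc, ← pow_succ']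

theorem re_trace_mul_le {l : Type*} [Fintype l] (A B : Matrix l l ℂ) :
    (A * B).trace.re ≤ ((A * Aᴴ).trace.re + (B * Bᴴ).trace.re) / 2 := by
  have h0 : 0 ≤ ((A - Bᴴ) * (A - Bᴴ)ᴴ).trace.re :=
    (Complex.nonneg_iff.1 (posSemidef_self_mul_conjTranspose (A - Bᴴ)).trace_nonneg).1
  have h1 : (Bᴴ * Aᴴ).trace.re = (A * B).trace.re := by
    rw [← conjTranspose_mul, trace_conjTranspose]; simp
  have h2 : (Bᴴ * B).trace.re = (B * Bᴴ).trace.re := by rw [trace_mul_comm]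
  rw [conjTranspose_sub, conjTranspose_conjTranspose, sub_mul, mul_sub, mul_sub] at h0
  simp only [trace_sub, Complex.sub_re] at h0
  linarith

theorem re_trace_pow_two_pow_le (r : ℕ) :
    (∀ X : Matrix n n ℂ, (X ^ 2 ^ (r + 1)).trace.re ≤ ((X * Xᴴ) ^ 2 ^ r).trace.re) ∧
    (∀ A B : Matrix n n ℂ, A.IsHermitian → B.IsHermitian →
      ((A * B) ^ 2 ^ r).trace.re ≤ (A ^ 2 ^ r * B ^ 2 ^ r).trace.re) := by
  induction r with
  | zero =>
    refine ⟨fun X => ?_, fun A B _ _ => by simp⟩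
    have := re_trace_mul_le X X
    simp only [zero_add, pow_one, pow_zero, pow_two]
    linarith
  | succ r ih =>
    obtain ⟨ih1, ih2⟩ := ih
    refine ⟨fun X => ?_, fun A B hA hB => ?_⟩
    · calc (X ^ 2 ^ (r + 1 + 1)).trace.re = ((X * X) ^ 2 ^ (r + 1)).trace.re := by
            rw [← pow_two, ← pow_mul, pow_succ' 2 (r + 1)]
        _ ≤ ((X * X * (X * X)ᴴ) ^ 2 ^ r).trace.re := ih1 _
        _ = ((Xᴴ * X * (X * Xᴴ)) ^ 2 ^ r).trace.re := by
            rw [conjTranspose_mul, ← mul_assoc, trace_mul_pow_comm]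
            simp only [mul_assoc]
        _ ≤ ((Xᴴ * X) ^ 2 ^ r * (X * Xᴴ) ^ 2 ^ r).trace.re :=
            ih2 _ _ (isHermitian_conjTranspose_mul_self X) (isHermitian_mul_conjTranspose_self X)
        _ ≤ _ := re_trace_mul_le _ _
        _ = _ := by
            rw [((isHermitian_conjTranspose_mul_self X).pow _).eq,
              ((isHermitian_mul_conjTranspose_self X).pow _).eq, ← pow_add, ← pow_add, ← two_mul,
              ← pow_succ', trace_mul_pow_comm Xᴴ X]
            ring
    · calc ((A * B) ^ 2 ^ (r + 1)).trace.re ≤ ((A * B * (A * B)ᴴ) ^ 2 ^ r).trace.re := ih1 _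
        _ = ((A * A * (B * B)) ^ 2 ^ r).trace.re := by
            rw [conjTranspose_mul, hA.eq, hB.eq, ← mul_assoc, trace_mul_pow_comm]
            simp only [mul_assoc]
        _ ≤ ((A * A) ^ 2 ^ r * (B * B) ^ 2 ^ r).trace.re :=
            ih2 _ _ (by rw [← pow_two]; exact hA.pow 2) (by rw [← pow_two]; exact hB.pow 2)
        _ = _ := by rw [← pow_two, ← pow_two, ← pow_mul, ← pow_mul, ← pow_succ']

/-- A Lieb–Thirring trace inequality for exponents that are powers of two. -/
theorem re_trace_mul_pow_le {A B : Matrix n n ℂ} (hA : A.IsHermitian) (hB : B.IsHermitian)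
    (r : ℕ) : ((A * B) ^ 2 ^ r).trace.re ≤ (A ^ 2 ^ r * B ^ 2 ^ r).trace.re :=
  (re_trace_pow_two_pow_le r).2 A B hA hB

theorem rankOneDown_pow {γ s : ℝ} (hγ : 0 ≤ γ) {a : n → ℂ} (ha : ∑ i, ‖a i‖ ^ 2 ≤ s) (k : ℕ)
    (hk : γ * s * k ≤ 1 / 2) :
    ∃ g : ℝ, γ * k / 2 ≤ g ∧ rankOneDown γ a ^ k = rankOneDown g a := by
  set q := ∑ i, ‖a i‖ ^ 2 with hq
  have hq0 : 0 ≤ q := Finset.sum_nonneg fun i _ => by positivity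
  have hdot : star a ⬝ᵥ a = (q : ℂ) := by
    rw [dotProduct, hq, Complex.ofReal_sum]
    refine Finset.sum_congr rfl fun i _ => ?_
    rw [Pi.star_apply, RCLike.star_def, Complex.conj_mul']
    norm_cast
  suffices h : ∃ g : ℝ, γ * k / 2 ≤ g ∧ g ≤ γ * k ∧ rankOneDown γ a ^ k = rankOneDown g a by
    obtain ⟨g, h1, _, h3⟩ := h
    exact ⟨g, h1, h3⟩
  induction k with
  | zero => exact ⟨0, by simp, by simp, by simp [rankOneDown]⟩
  | succ k ih =>
    have hs0 : 0 ≤ s := hq0.trans ha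
    push_cast at hk ⊢
    obtain ⟨g, h1, h2, h3⟩ := ih (by nlinarith [mul_nonneg hγ hs0])
    have hg0 : 0 ≤ g := le_trans (by positivity) h1
    have hgq : g * q ≤ 1 / 2 := by
      calc g * q ≤ γ * k * s := by gcongr
        _ ≤ 1 / 2 := by nlinarith [mul_nonneg hγ hs0]
    refine ⟨g + γ - γ * q * g, ?_, ?_, ?_⟩
    · nlinarith
    · nlinarith [mul_nonneg (mul_nonneg hγ hq0) hg0]
    · rw [pow_succ, h3]
      unfold rankOneDown
      rw [sub_mul, mul_sub, mul_sub, one_mul, one_mul, mul_one, smul_mul_smul_comm,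
        vecMulVec_mul_vecMulVec, hdot]
      ext i j
      simp [vecMulVec_apply]
      ring

end TracePower

section LowerBound

open Matrix
open scoped ComplexOrder

variable {n : Type*} [Fintype n] [DecidableEq n] {D : Type*}

theorem norm_sub_smul_sub_sq_le {E : Type*} [NormedAddCommGroup E] [InnerProductSpace ℂ E]
    {γ s : ℝ} (hγ : 0 ≤ γ) (hγs : γ * s ≤ 1) (y z a : E) (ha : ‖a‖ ^ 2 ≤ s) :
    ‖y - ((γ : ℂ) * inner ℂ a y) • a - z‖ ^ 2 ≤ ‖y - z‖ ^ 2 + γ * ‖inner ℂ a z‖ ^ 2 := by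
  set α := inner ℂ a y with hα
  set β := inner ℂ a z with hβ
  have h1 : RCLike.re (inner ℂ (y - z) (((γ : ℂ) * α) • a)) =
      γ * (‖α‖ ^ 2 - (α * (starRingEnd ℂ) β).re) := by
    rw [inner_smul_right, ← inner_conj_symm (y - z) a, inner_sub_right, ← hα, ← hβ, map_sub,
      mul_assoc, mul_sub, Complex.mul_conj, Complex.normSq_eq_norm_sq]
    simp only [RCLike.re_to_complex, Complex.re_ofReal_mul, Complex.sub_re, Complex.ofReal_re]
  have h2 : ‖((γ : ℂ) * α) • a‖ ^ 2 = γ * (γ * ‖a‖ ^ 2) * ‖α‖ ^ 2 := by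
    rw [norm_smul, norm_mul, Complex.norm_real, Real.norm_eq_abs, abs_of_nonneg hγ]
    ring
  have h3 : γ * ‖a‖ ^ 2 ≤ 1 := (mul_le_mul_of_nonneg_left ha hγ).trans hγs
  have h4 : γ * (γ * ‖a‖ ^ 2) * ‖α‖ ^ 2 ≤ γ * 1 * ‖α‖ ^ 2 := by gcongr
  have h5 : (α * (starRingEnd ℂ) β).re ≤ ‖α‖ * ‖β‖ := by
    refine (Complex.re_le_norm _).trans ?_
    rw [norm_mul, RCLike.norm_conj]
  rw [sub_right_comm, @norm_sub_sq ℂ, h1, h2]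
  nlinarith [mul_nonneg hγ (sq_nonneg (‖α‖ - ‖β‖)), mul_le_mul_of_nonneg_left h5 hγ]

/-- The state update multiplying by `I - γ a aᴴ`. -/
noncomputable def downUpdate (γ : ℝ) (a : D → EuclideanSpace ℂ n) (B : Matrix n n ℂ) (d : D) :
    Matrix n n ℂ :=
  rankOneDown γ (a d) * B

theorem toLp_downUpdate_mulVec (γ : ℝ) (a : D → EuclideanSpace ℂ n) (B : Matrix n n ℂ) (d : D)
    (v : n → ℂ) :
    WithLp.toLp 2 (downUpdate γ a B d *ᵥ v) = WithLp.toLp 2 (B *ᵥ v) -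
      ((γ : ℂ) * inner ℂ (a d) (WithLp.toLp 2 (B *ᵥ v))) • a d := by
  rw [downUpdate, rankOneDown, ← mulVec_mulVec, sub_mulVec, one_mulVec, smul_mulVec,
    vecMulVec_mulVec, EuclideanSpace.inner_eq_star_dotProduct, dotProduct_comm]
  ext i
  simp
  ring

theorem norm_iterRun_mulVec_sub_sq_le {γ s : ℝ} (hγ : 0 ≤ γ) (hγs : γ * s ≤ 1)
    {a : D → EuclideanSpace ℂ n} (ha : ∀ d, ‖a d‖ ^ 2 ≤ s) (m : ℕ) (t : Fin m → D)
    (B : Matrix n n ℂ) (v : n → ℂ) (z : EuclideanSpace ℂ n) :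
    ‖WithLp.toLp 2 (iterRun (downUpdate γ a) m t B *ᵥ v) - z‖ ^ 2 ≤
      ‖WithLp.toLp 2 (B *ᵥ v) - z‖ ^ 2 + γ * ∑ k, ‖inner ℂ (a (t k)) z‖ ^ 2 := by
  induction m generalizing B with
  | zero => simp [iterRun]
  | succ m ih =>
    have h := ih (Fin.tail t) (downUpdate γ a B (t 0))
    have h1 := norm_sub_smul_sub_sq_le hγ hγs (WithLp.toLp 2 (B *ᵥ v)) z (a (t 0)) (ha _)
    rw [toLp_downUpdate_mulVec] at h
    rw [Fin.sum_univ_succ]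
    simp only [iterRun, Fin.tail] at h ⊢
    linarith

open scoped Matrix.Norms.L2Operator in
theorem l2_opNorm_sq_le_trace (C : Matrix n n ℂ) : ‖C‖ ^ 2 ≤ (Cᴴ * C).trace.re := by
  have h0 : 0 ≤ (Cᴴ * C).trace.re :=
    (Complex.nonneg_iff.1 (posSemidef_conjTranspose_mul_self C).trace_nonneg).1
  have htr : (Cᴴ * C).trace.re = ∑ i, ∑ j, ‖C i j‖ ^ 2 := by
    rw [trace, Complex.re_sum, Finset.sum_comm]
    refine Finset.sum_congr rfl fun j _ => ?_
    rw [diag_apply, mul_apply, Complex.re_sum]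
    refine Finset.sum_congr rfl fun i _ => ?_
    rw [conjTranspose_apply, RCLike.star_def, Complex.conj_mul']
    norm_cast
  refine (Real.le_sqrt (norm_nonneg _) h0).1 ?_
  rw [l2_opNorm_def]
  refine ContinuousLinearMap.opNorm_le_bound _ (Real.sqrt_nonneg _) fun v => ?_
  rw [EuclideanSpace.norm_eq, EuclideanSpace.norm_eq, ← Real.sqrt_mul h0]
  refine Real.sqrt_le_sqrt ?_
  rw [htr, Finset.sum_mul]
  refine Finset.sum_le_sum fun i _ => ?_
  have h2 : ‖(C *ᵥ v) i‖ ≤ ∑ j, ‖C i j‖ * ‖v j‖ := by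
    rw [mulVec, dotProduct]
    refine (norm_sum_le _ _).trans (le_of_eq ?_)
    simp
  calc _ ≤ (∑ j, ‖C i j‖ * ‖v j‖) ^ 2 := by gcongr; exact h2
    _ ≤ _ := Finset.sum_mul_sq_le_sq_mul_sq _ _ _

open scoped Matrix.Norms.L2Operator in
theorem l2_opNorm_pow_le_trace (B : Matrix n n ℂ) (r : ℕ) :
    (‖B‖ ^ 2) ^ 2 ^ r ≤ ((Bᴴ * B) ^ 2 ^ r).trace.re := by
  have hsa : IsSelfAdjoint (Bᴴ * B) := isHermitian_conjTranspose_mul_self B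
  have h1 : (‖B‖ ^ 2) ^ 2 ^ r = ‖(Bᴴ * B) ^ 2 ^ r‖ := by
    have h := hsa.nnnorm_pow_two_pow r
    have h' : ‖(Bᴴ * B) ^ 2 ^ r‖ = ‖Bᴴ * B‖ ^ 2 ^ r := by
      simpa using congrArg NNReal.toReal h
    rw [h', ← star_eq_conjTranspose, CStarRing.norm_star_mul_self, pow_two]
  rw [h1]
  cases r with
  | zero =>
    rw [pow_zero, pow_one, ← star_eq_conjTranspose, CStarRing.norm_star_mul_self, ← pow_two]
    exact l2_opNorm_sq_le_trace B
  | succ r =>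
    have hsq : (Bᴴ * B) ^ 2 ^ (r + 1) = ((Bᴴ * B) ^ 2 ^ r)ᴴ * (Bᴴ * B) ^ 2 ^ r := by
      rw [((isHermitian_conjTranspose_mul_self B).pow _).eq, ← pow_add, pow_succ, mul_two]
    rw [hsq, ← star_eq_conjTranspose ((Bᴴ * B) ^ 2 ^ r), CStarRing.norm_star_mul_self, ← pow_two]
    exact l2_opNorm_sq_le_trace _

open scoped Matrix.Norms.L2Operator in
/-- If the product of the rank-one contractions is small, the samples control the norm. -/
theorem norm_sq_le_sum_inner_sq {γ s : ℝ} (hγ : 0 ≤ γ) (hγs : γ * s ≤ 1)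
    {a : D → EuclideanSpace ℂ n} (ha : ∀ d, ‖a d‖ ^ 2 ≤ s) (m : ℕ) (t : Fin m → D) (r : ℕ)
    (h : (((iterRun (downUpdate γ a) m t 1)ᴴ * iterRun (downUpdate γ a) m t 1) ^ 2 ^ r).trace.re <
      (1 / 4) ^ 2 ^ r) (z : EuclideanSpace ℂ n) :
    ‖z‖ ^ 2 ≤ 4 * γ * ∑ k, ‖inner ℂ (a (t k)) z‖ ^ 2 := by
  set T := iterRun (downUpdate γ a) m t 1
  have h1 : ‖T‖ ^ 2 < 1 / 4 :=
    lt_of_pow_lt_pow_left₀ _ (by norm_num) ((l2_opNorm_pow_le_trace T r).trans_lt h)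
  have h2 : ‖T‖ ≤ 1 / 2 := by nlinarith [norm_nonneg T]
  have h3 : ‖WithLp.toLp 2 (T *ᵥ z)‖ ≤ ‖T‖ * ‖z‖ := l2_opNorm_mulVec T z
  have h4 := norm_iterRun_mulVec_sub_sq_le hγ hγs ha m t 1 z z
  rw [one_mulVec] at h4
  simp only [WithLp.toLp_ofLp, sub_self, norm_zero] at h4
  have h5 : ‖z‖ / 2 ≤ ‖WithLp.toLp 2 (T *ᵥ z) - z‖ := by
    have := norm_sub_norm_le z (WithLp.toLp 2 (T *ᵥ z))
    rw [norm_sub_rev] at this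
    nlinarith [norm_nonneg z]
  have h6 : (‖z‖ / 2) ^ 2 ≤ ‖WithLp.toLp 2 (T *ᵥ z) - z‖ ^ 2 := by gcongr
  linarith

theorem re_trace_downUpdate_le {γ s : ℝ} (hγ : 0 ≤ γ) {a : D → EuclideanSpace ℂ n}
    (ha : ∀ d, ‖a d‖ ^ 2 ≤ s) (r : ℕ) (hr : γ * s * (2 * 2 ^ r) ≤ 1 / 2) (B : Matrix n n ℂ)
    (d : D) :
    (((downUpdate γ a B d)ᴴ * downUpdate γ a B d) ^ 2 ^ r).trace.re ≤
      ((Bᴴ * B) ^ 2 ^ r).trace.re -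
        γ * 2 ^ r * (star (a d).ofLp ⬝ᵥ (B * Bᴴ) ^ 2 ^ r *ᵥ (a d).ofLp).re := by
  set P := rankOneDown γ (a d).ofLp with hP
  set H := (B * Bᴴ) ^ 2 ^ r with hH
  have hPh : P.IsHermitian := isHermitian_rankOneDown _ _
  have hHp : H.PosSemidef := (posSemidef_self_mul_conjTranspose B).pow _
  obtain ⟨g, hg, hPg⟩ := rankOneDown_pow (s := s) hγ (a := (a d).ofLp)
    (by rw [← EuclideanSpace.norm_sq_eq]; exact ha d) (2 * 2 ^ r) (by push_cast; exact hr)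
  push_cast at hg
  have h0 : 0 ≤ (star (a d).ofLp ⬝ᵥ H *ᵥ (a d).ofLp).re :=
    (Complex.nonneg_iff.1 (hHp.dotProduct_mulVec_nonneg _)).1
  calc _ = ((Bᴴ * (P * P * B)) ^ 2 ^ r).trace.re := by
        rw [downUpdate, ← hP, conjTranspose_mul, hPh.eq]; simp only [mul_assoc]
    _ = ((P * P * (B * Bᴴ)) ^ 2 ^ r).trace.re := by
        rw [trace_mul_pow_comm]; simp only [mul_assoc]
    _ ≤ ((P * P) ^ 2 ^ r * H).trace.re :=
        re_trace_mul_pow_le (by rw [← pow_two]; exact hPh.pow 2)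
          (isHermitian_mul_conjTranspose_self B) r
    _ = H.trace.re - g * (star (a d).ofLp ⬝ᵥ H *ᵥ (a d).ofLp).re := by
        rw [← pow_two, ← pow_mul, hPg, rankOneDown, sub_mul, one_mul, smul_mul, trace_sub,
          trace_smul, vecMulVec_mul, trace_vecMulVec, dotProduct_comm, ← dotProduct_mulVec]
        simp
    _ ≤ H.trace.re - γ * 2 ^ r * (star (a d).ofLp ⬝ᵥ H *ᵥ (a d).ofLp).re := by
        gcongr
        linarith
    _ = _ := by rw [hH, trace_mul_pow_comm]

noncomputable instance : MeasurableSpace (Matrix n n ℂ) :=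
  inferInstanceAs (MeasurableSpace (n → n → ℂ))

instance : BorelSpace (Matrix n n ℂ) := inferInstanceAs (BorelSpace (n → n → ℂ))

variable [MeasurableSpace D]

theorem measurable_downUpdate (γ : ℝ) {a : D → EuclideanSpace ℂ n} (ha : Measurable a) :
    Measurable (Function.uncurry (downUpdate γ a)) := by
  refine measurable_pi_iff.2 fun i => measurable_pi_iff.2 fun j => ?_
  have hai : ∀ i, Measurable fun p : Matrix n n ℂ × D => a p.2 i := fun i =>
    (EuclideanSpace.proj (𝕜 := ℂ) i).continuous.measurable.comp (ha.comp measurable_snd)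
  have hB : ∀ k, Measurable fun p : Matrix n n ℂ × D => p.1 k j := fun k =>
    (measurable_pi_apply j).comp ((measurable_pi_apply k).comp measurable_fst)
  have : (fun p : Matrix n n ℂ × D => Function.uncurry (downUpdate γ a) p i j) =
      fun p => ∑ k, ((1 : Matrix n n ℂ) i k - γ * (a p.2 i * star (a p.2 k))) * p.1 k j := by
    funext p
    simp [Function.uncurry, downUpdate, rankOneDown, mul_apply, vecMulVec_apply]
  change Measurable fun p : Matrix n n ℂ × D => Function.uncurry (downUpdate γ a) p i j
  rw [this]
  refine Finset.measurable_sum _ fun k _ => ?_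
  exact (measurable_const.sub (((hai i).mul (continuous_star.measurable.comp (hai k))).const_mul
    _)).mul (hB k)

theorem measure_trace_iterRun_ge_le {γ s : ℝ} (hγ : 0 ≤ γ) (hs : 1 ≤ s)
    {a : D → EuclideanSpace ℂ n} (ham : Measurable a) (ha : ∀ d, ‖a d‖ ^ 2 ≤ s) (μ : Measure D)
    [IsProbabilityMeasure μ]
    (hiso : ∀ i j, ∫ d, star (a d i) * a d j ∂μ = if i = j then 1 else 0) (r : ℕ)
    (hr : γ * s * (2 * 2 ^ r) ≤ 1 / 2) (m : ℕ) {b : ℝ} (hb : 0 < b) :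
    (Measure.pi fun _ : Fin m => μ) {t | b ≤ (((iterRun (downUpdate γ a) m t 1)ᴴ *
        iterRun (downUpdate γ a) m t 1) ^ 2 ^ r).trace.re} ≤
      ENNReal.ofReal ((1 - γ * 2 ^ r) ^ m * Fintype.card n / b) := by
  have hai : ∀ i, Measurable fun d => a d i := fun i =>
    (EuclideanSpace.proj (𝕜 := ℂ) i).continuous.measurable.comp ham
  have hab : ∀ i d, ‖a d i‖ ≤ s := fun i d => by
    have h1 : ‖a d i‖ ≤ ‖a d‖ := PiLp.norm_apply_le _ _
    nlinarith [ha d, norm_nonneg (a d)]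
  have hint : ∀ i j, Integrable (fun d => star (a d i) * a d j) μ := fun i j => by
    refine Integrable.of_bound ((continuous_star.measurable.comp (hai i)).mul (hai
      j)).aestronglyMeasurable (s * s)
      (Filter.Eventually.of_forall fun d => ?_)
    rw [norm_mul, norm_star]
    have := hab i d
    have := hab j d
    gcongr
  have hexpand : ∀ (H : Matrix n n ℂ) d, star (a d).ofLp ⬝ᵥ H *ᵥ (a d).ofLp =
      ∑ i, ∑ j, H i j * (star (a d i) * a d j) := by
    intro H d
    simp only [dotProduct, mulVec, Finset.mul_sum, Pi.star_apply]
    refine Finset.sum_congr rfl fun i _ => Finset.sum_congr rfl fun j _ => by ring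
  have hinti : ∀ H : Matrix n n ℂ,
      Integrable (fun d => star (a d).ofLp ⬝ᵥ H *ᵥ (a d).ofLp) μ := fun H => by
    simp_rw [hexpand]
    exact integrable_finsetSum _ fun i _ => integrable_finsetSum _ fun j _ =>
      (hint i j).const_mul _
  have hre : ∀ H : Matrix n n ℂ,
      Integrable (fun d => (star (a d).ofLp ⬝ᵥ H *ᵥ (a d).ofLp).re) μ := fun H => (hinti H).re
  have hval : ∀ H : Matrix n n ℂ, ∫ d, (star (a d).ofLp ⬝ᵥ H *ᵥ (a d).ofLp).re ∂μ = H.trace.re := by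
    intro H
    have h1 : ∫ d, star (a d).ofLp ⬝ᵥ H *ᵥ (a d).ofLp ∂μ = H.trace := by
      rw [integral_congr_ae (Filter.Eventually.of_forall (hexpand H))]
      refine (integral_finsetSum _ fun i _ => integrable_finsetSum _ fun j _ =>
        (hint i j).const_mul (H i j)).trans ?_
      refine Finset.sum_congr rfl fun i _ => ?_
      refine (integral_finsetSum _ fun j _ => (hint i j).const_mul (H i j)).trans ?_
      simp only [integral_const_mul, hiso]
      simp
    have h2 := integral_re (hinti H)
    simp only [RCLike.re_to_complex] at h2
    rw [h2, h1]
  have h2r : γ * 2 ^ r ≤ 1 := by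
    nlinarith [mul_nonneg hγ (show (0 : ℝ) ≤ 2 ^ r by positivity)]
  have hmain := measure_iterRun_ge_le μ (measurable_downUpdate γ ham)
    (V := fun B => ((Bᴴ * B) ^ 2 ^ r).trace.re)
    (Continuous.measurable (by fun_prop))
    (fun B => (Complex.nonneg_iff.1
      (((posSemidef_conjTranspose_mul_self B).pow _).trace_nonneg)).1)
    (c := 1 - γ * 2 ^ r) (by linarith) (re_trace_downUpdate_le hγ ha r hr)
    (fun B => (integrable_const _).sub ((hre _).const_mul _))
    (fun B => by
      rw [integral_sub (integrable_const _) ((hre _).const_mul _), integral_const_mul, hval,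
        trace_mul_pow_comm B]
      simp only [integral_const, probReal_univ, one_smul]
      linarith) m 1 hb
  refine hmain.trans (le_of_eq ?_)
  simp

end LowerBound

section Deterministic

variable {I : Type*}

/-- The restriction of a sequence to a finite index set, as a Euclidean vector. -/
noncomputable def restrictVec (Δ : Finset I) (z : I → ℂ) : EuclideanSpace ℂ Δ :=
  WithLp.toLp 2 fun i => z i

theorem norm_restrictVec_sq (Δ : Finset I) (z : I → ℂ) :
    ‖restrictVec Δ z‖ ^ 2 = ∑ i ∈ Δ, ‖z i‖ ^ 2 := by
  rw [EuclideanSpace.norm_sq_eq, ← Finset.sum_coe_sort Δ fun i => ‖z i‖ ^ 2]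
  rfl

theorem inner_restrictVec (Δ : Finset I) (a z : I → ℂ) :
    inner ℂ (restrictVec Δ a) (restrictVec Δ z) = ∑ i ∈ Δ, (starRingEnd ℂ) (a i) * z i := by
  rw [PiLp.inner_apply, ← Finset.sum_coe_sort Δ fun i => (starRingEnd ℂ) (a i) * z i]
  exact Finset.sum_congr rfl fun i _ => by simp [restrictVec, mul_comm]

theorem restrictVec_surjective [DecidableEq I] (Δ : Finset I) :
    Function.Surjective (restrictVec Δ) := fun z =>
  ⟨fun i => if h : i ∈ Δ then z ⟨i, h⟩ else 0, by ext i; simp [restrictVec]⟩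

theorem l2m_eq_norm {m : ℕ} (y : Fin m → ℂ) : l2m y = ‖WithLp.toLp 2 y‖ := by
  rw [EuclideanSpace.norm_eq]; rfl

theorem l2m_sub_le {m : ℕ} (y z : Fin m → ℂ) : l2m (fun k => y k - z k) ≤ l2m y + l2m z := by
  simp only [l2m_eq_norm]
  exact norm_sub_le (WithLp.toLp 2 y) (WithLp.toLp 2 z)

theorem norm_sum_mul_le_l2m {m : ℕ} (y z : Fin m → ℂ) : ‖∑ k, y k * z k‖ ≤ l2m y * l2m z := by
  refine (norm_sum_le _ _).trans ?_
  simp only [norm_mul]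
  exact Real.sum_mul_le_sqrt_mul_sqrt _ _ _

theorem l2m_sum_le {m : ℕ} {S : Finset I} (f : I → Fin m → ℂ) :
    l2m (fun k => ∑ i ∈ S, f i k) ≤ ∑ i ∈ S, l2m (f i) := by
  simp only [l2m_eq_norm]
  have : WithLp.toLp 2 (fun k => ∑ i ∈ S, f i k) = ∑ i ∈ S, WithLp.toLp 2 (f i) := by
    ext k; simp
  rw [this]
  exact norm_sum_le _ _

theorem l2m_const_mul_le {m : ℕ} {c : ℂ} {f : Fin m → ℂ} {b : ℝ} (hb : 0 ≤ b)
    (hf : ∀ k, ‖f k‖ ≤ b) :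
    l2m (fun k => c * f k) ≤ ‖c‖ * (Real.sqrt m * b) := by
  refine Real.sqrt_le_iff.2 ⟨by positivity, ?_⟩
  calc ∑ k, ‖c * f k‖ ^ 2 ≤ ∑ _k : Fin m, (‖c‖ * b) ^ 2 := by
        gcongr with k; rw [norm_mul]; gcongr; exact hf k
    _ = _ := by
        rw [Finset.sum_const, Finset.card_univ, Fintype.card_fin, nsmul_eq_mul, mul_pow, mul_pow,
          mul_pow, Real.sq_sqrt (Nat.cast_nonneg _)]
        ring

theorem Uapp0_eq_sum {D : Type*} (φ : I → D → ℂ) {m : ℕ} (t : Fin m → D) {IK : Finset I}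
    {z : I → ℂ} (hz : ∀ i ∉ IK, z i = 0) (k : Fin m) :
    Uapp0 φ t z k = ∑ i ∈ IK, z i * φ i (t k) :=
  tsum_eq_sum fun i hi => by rw [hz i hi, zero_mul]

/-- An `ℓ²` bound for a sum of a finitely supported and an absolutely summable sequence. -/
theorem l2I_le_add {z p r : I → ℂ} {G R : ℝ} (hG : 0 ≤ G) (hR : 0 ≤ R)
    (hz : ∀ i, z i = p i + r i) (hp : ∀ S : Finset I, ∑ i ∈ S, ‖p i‖ ^ 2 ≤ G ^ 2)
    (hr : ∀ S : Finset I, ∑ i ∈ S, ‖r i‖ ≤ R) : l2I z ≤ G + R := by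
  refine Real.sqrt_le_iff.2 ⟨by positivity, ?_⟩
  refine tsum_le_of_sum_le' (by positivity) fun S => ?_
  have hp1 : ∀ i, ‖p i‖ ≤ G := fun i => by
    have := hp {i}
    rw [Finset.sum_singleton] at this
    exact le_of_sq_le_sq this hG
  have hr1 : ∀ i, ‖r i‖ ≤ R := fun i => by simpa using hr {i}
  calc ∑ i ∈ S, ‖z i‖ ^ 2 ≤ ∑ i ∈ S, (‖p i‖ ^ 2 + (2 * G + R) * ‖r i‖) := by
        refine Finset.sum_le_sum fun i _ => ?_
        have h1 : ‖z i‖ ≤ ‖p i‖ + ‖r i‖ := by rw [hz]; exact norm_add_le _ _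
        nlinarith [mul_le_mul_of_nonneg_right (hp1 i) (norm_nonneg (r i)),
          mul_le_mul_of_nonneg_right (hr1 i) (norm_nonneg (r i)), norm_nonneg (z i),
          norm_nonneg (p i), norm_nonneg (r i)]
    _ ≤ G ^ 2 + (2 * G + R) * R := by
        rw [Finset.sum_add_distrib, ← Finset.mul_sum]
        gcongr
        · exact hp S
        · exact hr S
    _ = _ := by ring

/-- The vector `(w_i sgn x_i)` generating the subdifferential of the weighted `ℓ¹` norm. -/
noncomputable def weightedSign (w : I → ℝ) (x : I → ℂ) (i : I) : ℂ := w i * (x i / ‖x i‖)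

theorem norm_weightedSign_le {w : I → ℝ} (hw : ∀ i, 0 < w i) (x : I → ℂ) (i : I) :
    ‖weightedSign w x i‖ ≤ w i := by
  rw [weightedSign, norm_mul, norm_div, Complex.norm_real, Complex.norm_real, norm_norm,
    Real.norm_eq_abs, abs_of_pos (hw i)]
  exact mul_le_of_le_one_right (hw i).le (div_self_le_one _)

theorem mul_norm_add_re_le {w : I → ℝ} (hw : ∀ i, 0 < w i) (x h : I → ℂ) (i : I) :
    w i * ‖x i‖ + ((starRingEnd ℂ) (weightedSign w x i) * h i).re ≤ w i * ‖x i + h i‖ := by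
  have h1 : w i * ‖x i‖ + ((starRingEnd ℂ) (weightedSign w x i) * h i).re =
      ((starRingEnd ℂ) (weightedSign w x i) * (x i + h i)).re := by
    rw [mul_add, Complex.add_re]
    congr 1
    rw [weightedSign, map_mul, map_div₀, Complex.conj_ofReal, Complex.conj_ofReal, mul_assoc,
      div_mul_eq_mul_div, mul_comm _ (x i), Complex.mul_conj', pow_two, mul_self_div_self]
    norm_cast
  rw [h1]
  refine (Complex.re_le_norm _).trans ?_
  rw [norm_mul, RCLike.norm_conj]
  gcongr
  exact norm_weightedSign_le hw x i

/-- Off-support mass bound for a descent direction of the weighted `ℓ¹` norm. -/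
theorem sum_sdiff_le_of_sum_le [DecidableEq I] {IK Δ : Finset I} (hΔ : Δ ⊆ IK) {w : I → ℝ}
    (hw : ∀ i, 0 < w i) (x xh xb : I → ℂ)
    (hmin : ∑ i ∈ IK, w i * ‖xh i‖ ≤ ∑ i ∈ IK, w i * ‖xb i‖) :
    ∑ i ∈ IK \ Δ, w i * ‖xh i - xb i‖ ≤
      2 * ∑ i ∈ IK \ Δ, w i * ‖x i‖ + 2 * ∑ i ∈ IK, w i * ‖x i - xb i‖ -
        (∑ i ∈ Δ, (starRingEnd ℂ) (weightedSign w x i) * (xh i - xb i)).re := by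
  rw [← Finset.sum_sdiff hΔ, ← Finset.sum_sdiff hΔ] at hmin
  rw [← Finset.sum_sdiff (f := fun i => w i * ‖x i - xb i‖) hΔ, Complex.re_sum]
  have h1 : ∑ i ∈ Δ, w i * ‖xb i‖ - 2 * ∑ i ∈ Δ, w i * ‖x i - xb i‖ +
      ∑ i ∈ Δ, ((starRingEnd ℂ) (weightedSign w x i) * (xh i - xb i)).re ≤
      ∑ i ∈ Δ, w i * ‖xh i‖ := by
    rw [Finset.mul_sum, ← Finset.sum_sub_distrib, ← Finset.sum_add_distrib]
    refine Finset.sum_le_sum fun i _ => ?_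
    have h := mul_norm_add_re_le hw x (fun i => xh i - xb i) i
    have h2 : ‖x i + (xh i - xb i)‖ ≤ ‖xh i‖ + ‖x i - xb i‖ := by
      rw [show x i + (xh i - xb i) = xh i + (x i - xb i) by ring]; exact norm_add_le _ _
    have h3 : ‖xb i‖ ≤ ‖x i‖ + ‖x i - xb i‖ := norm_le_norm_add_norm_sub _ _
    have h4 := mul_le_mul_of_nonneg_left h2 (hw i).le
    have h5 := mul_le_mul_of_nonneg_left h3 (hw i).le
    linarith
  have h2 : ∑ i ∈ IK \ Δ, w i * ‖xh i - xb i‖ + ∑ i ∈ IK \ Δ, w i * ‖xb i‖ -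
      2 * ∑ i ∈ IK \ Δ, w i * ‖x i‖ - 2 * ∑ i ∈ IK \ Δ, w i * ‖x i - xb i‖ ≤
      ∑ i ∈ IK \ Δ, w i * ‖xh i‖ := by
    rw [Finset.mul_sum, Finset.mul_sum, ← Finset.sum_add_distrib, ← Finset.sum_sub_distrib,
      ← Finset.sum_sub_distrib]
    refine Finset.sum_le_sum fun i _ => ?_
    have h2 : ‖xh i - xb i‖ ≤ ‖xh i‖ + ‖xb i‖ := norm_sub_le _ _
    have h3 : ‖xb i‖ ≤ ‖x i‖ + ‖x i - xb i‖ := norm_le_norm_add_norm_sub _ _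
    have h4 := mul_le_mul_of_nonneg_left h2 (hw i).le
    have h5 := mul_le_mul_of_nonneg_left h3 (hw i).le
    linarith
  linarith

/-- Stable recovery from an inexact dual certificate. -/
theorem l2I_sub_le_of_dualCertificate [DecidableEq I] {D : Type*} {φ : I → D → ℂ} {w : I → ℝ}
    (hw : ∀ i, 1 ≤ w i) (hφ : ∀ i d, ‖φ i d‖ ≤ w i) {m : ℕ} (hm : 0 < m) (t : Fin m → D)
    {IK Δ : Finset I} (hΔ : Δ ⊆ IK) {s : ℝ} (hs : 1 ≤ s) {x : I → ℂ}
    (hx : Summable fun i => w i * ‖x i‖) {q : Fin m → ℂ} {r : EuclideanSpace ℂ Δ}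
    (hdec : restrictVec Δ (weightedSign w x) - r =
      ∑ k, q k • restrictVec Δ fun i => (starRingEnd ℂ) (φ i (t k)))
    (hq : ∑ k, ‖q k‖ ^ 2 ≤ 16 * s / m) (hr : ‖r‖ ≤ 1 / 16)
    (hoff : ∀ i ∈ IK \ Δ, ‖∑ k, q k * (starRingEnd ℂ) (φ i (t k))‖ ≤ w i / 2)
    (hlow : ∀ z, ‖z‖ ^ 2 ≤
      12 / m * ∑ k, ‖inner ℂ (restrictVec Δ fun i => (starRingEnd ℂ) (φ i (t k))) z‖ ^ 2)
    {y : Fin m → ℂ} {η : ℝ} (hη : 0 ≤ η) {xh xb : I → ℂ} (hxh : ∀ i ∉ IK, xh i = 0)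
    (hxb : ∀ i ∉ IK, xb i = 0) (hxhη : l2m (fun k => Uapp0 φ t xh k - y k) ≤ η)
    (hxbη : l2m (fun k => Uapp0 φ t xb k - y k) ≤ η)
    (hmin : (∑' i, w i * ‖xh i‖) ≤ ∑' i, w i * ‖xb i‖) :
    l2I (fun i => x i - xh i) ≤ 200 * (Real.sqrt s * (η / Real.sqrt m) +
      (∑' i, w i * ‖x i - proj Δ x i‖) + ∑' i, w i * ‖x i - xb i‖) := by
  have hw0 : ∀ i, 0 < w i := fun i => one_pos.trans_le (hw i)
  have hm0 : (0 : ℝ) < m := Nat.cast_pos.2 hm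
  have hsm : 0 < Real.sqrt m := Real.sqrt_pos.2 hm0
  have hsm2 : Real.sqrt m ^ 2 = m := Real.sq_sqrt hm0.le
  have hrs : 0 ≤ Real.sqrt s := Real.sqrt_nonneg s
  set v := η / Real.sqrt m with hv
  have hv0 : 0 ≤ v := by positivity
  set h : I → ℂ := fun i => xh i - xb i with hh
  set H := ∑ i ∈ IK \ Δ, w i * ‖h i‖ with hH
  have hH0 : 0 ≤ H := Finset.sum_nonneg fun i _ => mul_nonneg (hw0 i).le (norm_nonneg _)
  set b : Fin m → ℂ := fun k =>
    inner ℂ (restrictVec Δ fun i => (starRingEnd ℂ) (φ i (t k))) (restrictVec Δ h) with hb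
  -- The three pieces of the measurement of `h`.
  set Uh : Fin m → ℂ := fun k => ∑ i ∈ IK, h i * φ i (t k) with hUh
  have hUhη : l2m Uh ≤ 2 * η := by
    have h1 : Uh = fun k => (Uapp0 φ t xh k - y k) - (Uapp0 φ t xb k - y k) := by
      funext k
      rw [Uapp0_eq_sum φ t hxh, Uapp0_eq_sum φ t hxb, sub_sub_sub_cancel_right,
        ← Finset.sum_sub_distrib]
      exact Finset.sum_congr rfl fun i _ => sub_mul _ _ _
    rw [h1]
    linarith [l2m_sub_le (fun k => Uapp0 φ t xh k - y k) fun k => Uapp0 φ t xb k - y k]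
  have hbU : ∀ k, b k = Uh k - ∑ i ∈ IK \ Δ, h i * φ i (t k) := fun k => by
    rw [hb, hUh]
    simp only [inner_restrictVec, Complex.conj_conj]
    rw [← Finset.sum_sdiff hΔ, add_sub_cancel_left]
    exact Finset.sum_congr rfl fun i _ => mul_comm _ _
  have hql : l2m q ≤ 4 * Real.sqrt s / Real.sqrt m := by
    refine Real.sqrt_le_iff.2 ⟨by positivity, hq.trans (le_of_eq ?_)⟩
    rw [div_pow, mul_pow, hsm2, Real.sq_sqrt (by linarith)]
    norm_num
  -- The certificate tested against `h`.
  have hcert : ‖∑ i ∈ Δ, (starRingEnd ℂ) (weightedSign w x i) * h i‖ ≤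
      8 * (Real.sqrt s * v) + H / 2 + ‖restrictVec Δ h‖ / 16 := by
    have h1 : ∑ i ∈ Δ, (starRingEnd ℂ) (weightedSign w x i) * h i =
        ∑ k, (starRingEnd ℂ) (q k) * Uh k -
          ∑ i ∈ IK \ Δ, h i * (starRingEnd ℂ) (∑ k, q k * (starRingEnd ℂ) (φ i (t k))) +
          inner ℂ r (restrictVec Δ h) := by
      rw [← inner_restrictVec, ← sub_add_cancel (restrictVec Δ (weightedSign w x)) r,
        inner_add_left, hdec, sum_inner]
      congr 1
      simp only [inner_smul_left, map_sum, map_mul, Complex.conj_conj, Finset.mul_sum]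
      rw [Finset.sum_comm, ← Finset.sum_sub_distrib]
      refine Finset.sum_congr rfl fun k _ => ?_
      change _ * b k = _
      rw [hbU, mul_sub]
      congr 1
      rw [Finset.mul_sum]
      exact Finset.sum_congr rfl fun i _ => by ring
    have h2 : ‖∑ k, (starRingEnd ℂ) (q k) * Uh k‖ ≤ 8 * (Real.sqrt s * v) := by
      refine (norm_sum_mul_le_l2m _ _).trans ?_
      have h3 : l2m (fun k => (starRingEnd ℂ) (q k)) = l2m q := by simp [l2m]
      rw [h3]
      calc _ ≤ 4 * Real.sqrt s / Real.sqrt m * (2 * η) := by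
            gcongr
            exact Real.sqrt_nonneg _
        _ = _ := by rw [hv]; ring
    have h3 : ‖∑ i ∈ IK \ Δ, h i * (starRingEnd ℂ) (∑ k, q k * (starRingEnd ℂ) (φ i (t k)))‖ ≤
        H / 2 := by
      refine (norm_sum_le _ _).trans ?_
      rw [hH, Finset.sum_div]
      refine Finset.sum_le_sum fun i hi => ?_
      rw [norm_mul, RCLike.norm_conj]
      calc _ ≤ ‖h i‖ * (w i / 2) := by gcongr; exact hoff i hi
        _ = _ := by ring
    have h4 : ‖inner ℂ r (restrictVec Δ h)‖ ≤ ‖restrictVec Δ h‖ / 16 := by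
      refine (norm_inner_le_norm _ _).trans ?_
      calc _ ≤ 1 / 16 * ‖restrictVec Δ h‖ := by gcongr
        _ = _ := by ring
    rw [h1]
    refine (norm_add_le _ _).trans ?_
    linarith [norm_sub_le (∑ k, (starRingEnd ℂ) (q k) * Uh k)
      (∑ i ∈ IK \ Δ, h i * (starRingEnd ℂ) (∑ k, q k * (starRingEnd ℂ) (φ i (t k))))]
  have hbl : l2m b ≤ Real.sqrt m * (2 * v + H) := by
    have h1 : b = fun k => Uh k - ∑ i ∈ IK \ Δ, h i * φ i (t k) := funext hbU
    rw [h1]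
    refine (l2m_sub_le _ _).trans ?_
    have h2 : l2m (fun k => ∑ i ∈ IK \ Δ, h i * φ i (t k)) ≤ Real.sqrt m * H := by
      refine (l2m_sum_le _).trans ?_
      rw [hH, Finset.mul_sum]
      refine Finset.sum_le_sum fun i _ => ?_
      refine (l2m_const_mul_le (hw0 i).le fun k => hφ i (t k)).trans (le_of_eq ?_)
      ring
    have h3 : 2 * η = Real.sqrt m * (2 * v) := by rw [hv]; field_simp
    linarith
  have hG : ‖restrictVec Δ h‖ ≤ 4 * (2 * v + H) := by
    refine le_of_sq_le_sq ?_ (by positivity)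
    have h1 : ∑ k, ‖b k‖ ^ 2 ≤ (Real.sqrt m * (2 * v + H)) ^ 2 := (Real.sqrt_le_iff.1 hbl).2
    calc _ ≤ 12 / m * ∑ k, ‖b k‖ ^ 2 := hlow _
      _ ≤ 12 / m * (Real.sqrt m * (2 * v + H)) ^ 2 := by gcongr
      _ = 12 * (2 * v + H) ^ 2 := by rw [mul_pow, hsm2]; field_simp
      _ ≤ _ := by nlinarith [sq_nonneg (2 * v + H)]
  -- Comparison of finite and infinite sums.
  set T := ∑' i, w i * ‖x i - xb i‖ with hT
  set σ := ∑' i, w i * ‖x i - proj Δ x i‖ with hσ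
  have hTs : Summable fun i => w i * ‖x i - xb i‖ := by
    refine (summable_congr_cofinite ?_).1 hx
    filter_upwards [IK.finite_toSet.compl_mem_cofinite] with i hi
    rw [hxb i hi, sub_zero]
  have hσs : Summable fun i => w i * ‖x i - proj Δ x i‖ := by
    refine (summable_congr_cofinite ?_).1 hx
    filter_upwards [Δ.finite_toSet.compl_mem_cofinite] with i hi
    rw [proj, if_neg (Finset.mem_coe.not.1 hi), sub_zero]
  have hTle : ∀ S : Finset I, ∑ i ∈ S, w i * ‖x i - xb i‖ ≤ T := fun S =>
    hTs.sum_le_tsum S fun i _ => mul_nonneg (hw0 i).le (norm_nonneg _)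
  have hσle : ∑ i ∈ IK \ Δ, w i * ‖x i‖ ≤ σ := by
    refine le_trans (le_of_eq ?_)
      (hσs.sum_le_tsum (IK \ Δ) fun i _ => mul_nonneg (hw0 i).le (norm_nonneg _))
    refine Finset.sum_congr rfl fun i hi => ?_
    rw [proj, if_neg (Finset.mem_sdiff.1 hi).2, sub_zero]
  have hT0 : 0 ≤ T := by simpa using hTle ∅
  have hσ0 : 0 ≤ σ := (Finset.sum_nonneg fun i _ =>
    mul_nonneg (hw0 i).le (norm_nonneg (x i))).trans hσle
  have hcone : H ≤ 2 * σ + 2 * T + (8 * (Real.sqrt s * v) + H / 2 + ‖restrictVec Δ h‖ / 16) := by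
    rw [tsum_eq_sum (s := IK) fun i hi => by rw [hxh i hi, norm_zero, mul_zero],
      tsum_eq_sum (s := IK) fun i hi => by rw [hxb i hi, norm_zero, mul_zero]] at hmin
    have h1 := sum_sdiff_le_of_sum_le hΔ hw0 x xh xb hmin
    have h2 := Complex.abs_re_le_norm
      (∑ i ∈ Δ, (starRingEnd ℂ) (weightedSign w x i) * (xh i - xb i))
    have h3 := neg_le_of_abs_le h2
    have h4 := hTle IK
    change H ≤ _ at h1
    change ‖∑ i ∈ Δ, (starRingEnd ℂ) (weightedSign w x i) * (xh i - xb i)‖ ≤ _ at hcert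
    linarith
  have hfin : l2I (fun i => x i - xh i) ≤ ‖restrictVec Δ h‖ + (T + H) := by
    refine l2I_le_add (p := fun i => if i ∈ Δ then -h i else 0)
      (r := fun i => (x i - xb i) - if i ∈ IK \ Δ then h i else 0) (norm_nonneg _)
      (by positivity) (fun i => ?_) (fun S => ?_) fun S => ?_
    · by_cases h1 : i ∈ Δ
      · simp [h1, hh]
      · by_cases h2 : i ∈ IK
        · simp [h1, h2, hh]
        · simp [h1, h2, hxh i h2, hxb i h2]
    · rw [norm_restrictVec_sq]
      calc _ = ∑ i ∈ S, if i ∈ Δ then ‖h i‖ ^ 2 else 0 :=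
            Finset.sum_congr rfl fun i _ => by split_ifs <;> simp
        _ = ∑ i ∈ S ∩ Δ, ‖h i‖ ^ 2 := Finset.sum_ite_mem _ _ _
        _ ≤ _ := Finset.sum_le_sum_of_subset_of_nonneg Finset.inter_subset_right
            fun i _ _ => by positivity
    · calc _ ≤ ∑ i ∈ S, (w i * ‖x i - xb i‖ + if i ∈ IK \ Δ then w i * ‖h i‖ else 0) := by
            refine Finset.sum_le_sum fun i _ => (norm_sub_le _ _).trans ?_
            gcongr
            · exact le_mul_of_one_le_left (norm_nonneg _) (hw i)
            · split_ifs
              · exact le_mul_of_one_le_left (norm_nonneg _) (hw i)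
              · simp
        _ ≤ T + H := by
            rw [Finset.sum_add_distrib, Finset.sum_ite_mem]
            refine add_le_add (hTle S) ?_
            exact Finset.sum_le_sum_of_subset_of_nonneg Finset.inter_subset_right
              fun i _ _ => mul_nonneg (hw0 i).le (norm_nonneg _)
  have hvs : v ≤ Real.sqrt s * v := le_mul_of_one_le_left hv0 (Real.one_le_sqrt.2 hs)
  linarith

end Deterministic

section Probability

variable {I : Type*} {D : Type*} [MeasurableSpace D] {φ : I → D → ℂ} {w : I → ℝ}

theorem norm_restrictVec_sq_le {Δ : Finset I} {s : ℝ} (hΔs : ∑ i ∈ Δ, w i ^ 2 ≤ s) {z : I → ℂ}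
    (hz : ∀ i, ‖z i‖ ≤ w i) : ‖restrictVec Δ z‖ ^ 2 ≤ s := by
  rw [norm_restrictVec_sq]
  refine le_trans (Finset.sum_le_sum fun i _ => ?_) hΔs
  gcongr
  exact hz i

theorem measurable_restrictVec (hφm : ∀ i, Measurable (φ i)) (Δ : Finset I) :
    Measurable fun d => restrictVec Δ fun i => (starRingEnd ℂ) (φ i d) :=
  (WithLp.measurable_toLp 2 _).comp (measurable_pi_lambda _ fun i =>
    Complex.continuous_conj.measurable.comp (hφm i))

theorem integrable_conj_mul (hφm : ∀ i, Measurable (φ i)) (hφ : ∀ i d, ‖φ i d‖ ≤ w i)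
    (μ : Measure D) [IsProbabilityMeasure μ] (i j : I) :
    Integrable (fun d => (starRingEnd ℂ) (φ i d) * φ j d) μ := by
  refine Integrable.of_bound ((Complex.continuous_conj.measurable.comp (hφm i)).mul
    (hφm j)).aestronglyMeasurable (w i * w j) (Filter.Eventually.of_forall fun d => ?_)
  rw [norm_mul, RCLike.norm_conj]
  exact mul_le_mul (hφ i d) (hφ j d) (norm_nonneg _) ((norm_nonneg _).trans (hφ i d))

variable [DecidableEq I] {μ : Measure D} [IsProbabilityMeasure μ]

theorem integral_inner_restrictVec_mul_conj (hφm : ∀ i, Measurable (φ i))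
    (hφ : ∀ i d, ‖φ i d‖ ≤ w i)
    (hort : ∀ i j, (∫ d, (starRingEnd ℂ) (φ i d) * φ j d ∂μ) = if i = j then 1 else 0)
    (Δ : Finset I) (z : I → ℂ) (j : I) :
    Integrable (fun d => inner ℂ (restrictVec Δ fun i => (starRingEnd ℂ) (φ i d))
        (restrictVec Δ z) * (starRingEnd ℂ) (φ j d)) μ ∧
      ∫ d, inner ℂ (restrictVec Δ fun i => (starRingEnd ℂ) (φ i d)) (restrictVec Δ z) *
        (starRingEnd ℂ) (φ j d) ∂μ = if j ∈ Δ then z j else 0 := by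
  have h1 : (fun d => inner ℂ (restrictVec Δ fun i => (starRingEnd ℂ) (φ i d))
      (restrictVec Δ z) * (starRingEnd ℂ) (φ j d)) =
      fun d => ∑ i ∈ Δ, z i * ((starRingEnd ℂ) (φ j d) * φ i d) := by
    funext d
    rw [inner_restrictVec, Finset.sum_mul]
    refine Finset.sum_congr rfl fun i _ => ?_
    rw [Complex.conj_conj]
    ring
  have h2 : ∀ i ∈ Δ, Integrable (fun d => z i * ((starRingEnd ℂ) (φ j d) * φ i d)) μ :=
    fun i _ => (integrable_conj_mul hφm hφ μ j i).const_mul _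
  rw [h1]
  refine ⟨integrable_finsetSum _ h2, ?_⟩
  rw [integral_finsetSum _ h2]
  simp only [integral_const_mul, hort]
  simp

theorem integral_norm_inner_restrictVec_sq (hφm : ∀ i, Measurable (φ i))
    (hφ : ∀ i d, ‖φ i d‖ ≤ w i)
    (hort : ∀ i j, (∫ d, (starRingEnd ℂ) (φ i d) * φ j d ∂μ) = if i = j then 1 else 0)
    (Δ : Finset I) (z : EuclideanSpace ℂ Δ) :
    ∫ d, ‖inner ℂ (restrictVec Δ fun i => (starRingEnd ℂ) (φ i d)) z‖ ^ 2 ∂μ = ‖z‖ ^ 2 := by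
  obtain ⟨z, rfl⟩ := restrictVec_surjective Δ z
  have h1 : ∀ d, ((‖inner ℂ (restrictVec Δ fun i => (starRingEnd ℂ) (φ i d))
      (restrictVec Δ z)‖ ^ 2 : ℝ) : ℂ) = ∑ j ∈ Δ, (starRingEnd ℂ) (z j) *
        (inner ℂ (restrictVec Δ fun i => (starRingEnd ℂ) (φ i d)) (restrictVec Δ z) *
          (starRingEnd ℂ) (φ j d)) := by
    intro d
    rw [Complex.ofReal_pow, ← Complex.mul_conj']
    nth_rewrite 2 [inner_restrictVec]
    rw [map_sum, Finset.mul_sum]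
    refine Finset.sum_congr rfl fun j _ => ?_
    rw [map_mul, Complex.conj_conj]
    ring
  apply Complex.ofReal_injective
  rw [← integral_complex_ofReal]
  simp only [h1]
  rw [integral_finsetSum _ fun j _ =>
    (integral_inner_restrictVec_mul_conj hφm hφ hort Δ z j).1.const_mul _, norm_restrictVec_sq,
    Complex.ofReal_sum]
  refine Finset.sum_congr rfl fun j hj => ?_
  rw [integral_const_mul, (integral_inner_restrictVec_mul_conj hφm hφ hort Δ z j).2, if_pos hj,
    Complex.conj_mul', Complex.ofReal_pow]

theorem norm_le_half_of_re_I_pow_mul_lt {z : ℂ}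
    (hz : ∀ j ∈ Finset.range 4, (Complex.I ^ j * z).re < 1 / 3) : ‖z‖ ≤ 1 / 2 := by
  have h0 := hz 0 (by simp)
  have h1 := hz 1 (by simp)
  have h2 := hz 2 (by simp)
  have h3 := hz 3 (by simp)
  simp [pow_succ] at h0 h1 h2 h3
  refine le_of_sq_le_sq ?_ (by norm_num)
  rw [← Complex.normSq_eq_norm_sq, Complex.normSq_apply]
  nlinarith

theorem measure_kaczmarz_offSupport_le (hw : ∀ i, 1 ≤ w i) (hφm : ∀ i, Measurable (φ i))
    (hφ : ∀ i d, ‖φ i d‖ ≤ w i)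
    (hort : ∀ i j, (∫ d, (starRingEnd ℂ) (φ i d) * φ j d ∂μ) = if i = j then 1 else 0)
    {Δ : Finset I} {s κ : ℝ} (hs : 1 ≤ s) (hκ : 0 < κ) (hΔs : ∑ i ∈ Δ, w i ^ 2 ≤ s) (m : ℕ)
    (z : EuclideanSpace ℂ Δ) (hz : ‖z‖ ≤ Real.sqrt s) {i : I} (hi : i ∉ Δ) :
    (Measure.pi fun _ : Fin m => μ) {t | w i / 2 < ‖∑ k, kaczmarzCoeff s κ
        (fun d => restrictVec Δ fun i => (starRingEnd ℂ) (φ i d)) m t z k *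
          (starRingEnd ℂ) (φ i (t k))‖} ≤ ENNReal.ofReal (4 * Real.exp (-(κ / 144))) := by
  have hwi : 0 < w i := one_pos.trans_le (hw i)
  set a := fun d => restrictVec Δ fun i => (starRingEnd ℂ) (φ i d) with ha
  set c : ℕ → D → ℂ := fun j d => Complex.I ^ j * ((starRingEnd ℂ) (φ i d) / w i) with hc
  have hsub : {t : Fin m → D | w i / 2 < ‖∑ k, kaczmarzCoeff s κ a m t z k *
      (starRingEnd ℂ) (φ i (t k))‖} ⊆ ⋃ j ∈ Finset.range 4,
        {t | 1 / 3 ≤ ∑ k, (kaczmarzCoeff s κ a m t z k * c j (t k)).re} := by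
    intro t ht
    by_contra hcon
    simp only [Set.mem_iUnion, not_exists, Set.mem_ofPred_eq, not_le] at hcon ht
    refine absurd ht (not_lt.2 ?_)
    set ρ := ∑ k, kaczmarzCoeff s κ a m t z k * (starRingEnd ℂ) (φ i (t k)) with hρ
    have h1 : ‖ρ / w i‖ ≤ 1 / 2 := by
      refine norm_le_half_of_re_I_pow_mul_lt fun j hj => ?_
      refine lt_of_eq_of_lt ?_ (hcon j hj)
      rw [← Complex.re_sum, hρ, Finset.sum_div, Finset.mul_sum]
      congr 1
      refine Finset.sum_congr rfl fun k _ => ?_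
      rw [hc]
      ring
    rw [norm_div, Complex.norm_real, Real.norm_eq_abs, abs_of_pos hwi, div_le_iff₀ hwi] at h1
    linarith
  refine (measure_mono hsub).trans ((measure_biUnion_finset_le _ _).trans ?_)
  calc _ ≤ ∑ _j ∈ Finset.range 4, ENNReal.ofReal (Real.exp (-(κ / 144))) := by
        refine Finset.sum_le_sum fun j _ => ?_
        have hcm : Measurable (c j) :=
          ((Complex.continuous_conj.measurable.comp (hφm i)).div_const _).const_mul _
        refine measure_kaczmarz_corr_ge_le hs hκ (measurable_restrictVec hφm Δ)
          (fun d => norm_restrictVec_sq_le hΔs fun i => by rw [RCLike.norm_conj]; exact hφ i d) μ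
          hcm (fun d => ?_) (fun z => ?_) m z hz
        · rw [hc, norm_mul, norm_pow, Complex.norm_I, one_pow, one_mul, norm_div, RCLike.norm_conj,
            Complex.norm_real, Real.norm_eq_abs, abs_of_pos hwi, div_le_one hwi]
          exact hφ i d
        · obtain ⟨z, rfl⟩ := restrictVec_surjective Δ z
          have h := (integral_inner_restrictVec_mul_conj hφm hφ hort Δ z i).2
          rw [if_neg hi] at h
          calc _ = ∫ d, (Complex.I ^ j / w i) * (inner ℂ (restrictVec Δ fun i =>
                (starRingEnd ℂ) (φ i d)) (restrictVec Δ z) * (starRingEnd ℂ) (φ i d)) ∂μ := by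
                congr 1
                funext d
                rw [hc]
                ring
            _ = 0 := by rw [integral_const_mul, h, mul_zero]
    _ = _ := by
        rw [Finset.sum_const, Finset.card_range, ENNReal.ofReal_mul (by norm_num), nsmul_eq_mul]
        norm_num

theorem one_sub_le_measure_of_compl_subset {Ω : Type*} [MeasurableSpace Ω] {P : Measure Ω}
    [IsProbabilityMeasure P] {A G : Set Ω} (h : Aᶜ ⊆ G) {e : ENNReal} (hA : P A ≤ e) :
    1 - e ≤ P G := by
  rw [tsub_le_iff_right, ← measure_univ (μ := P), ← Set.compl_union_self A]
  exact (measure_union_le _ _).trans (add_le_add (measure_mono h) hA)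

open Matrix in
theorem measure_trace_iterRun_restrictVec_le (hw : ∀ i, 1 ≤ w i) (hφm : ∀ i, Measurable (φ i))
    (hφ : ∀ i d, ‖φ i d‖ ≤ w i)
    (hort : ∀ i j, (∫ d, (starRingEnd ℂ) (φ i d) * φ j d ∂μ) = if i = j then 1 else 0)
    {Δ : Finset I} {s : ℝ} (hs : 1 ≤ s) (hΔs : ∑ i ∈ Δ, w i ^ 2 ≤ s) {m : ℕ} (hm : (0 : ℝ) < m)
    {p : ℕ} (hp : 3 / (m : ℝ) * s * (2 * 2 ^ p) ≤ 1 / 2) :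
    (Measure.pi fun _ : Fin m => μ) {t | (1 / 4) ^ 2 ^ p ≤
      (((iterRun (downUpdate (3 / (m : ℝ)) fun d => restrictVec Δ fun i =>
          (starRingEnd ℂ) (φ i d)) m t 1)ᴴ *
        iterRun (downUpdate (3 / (m : ℝ)) fun d => restrictVec Δ fun i =>
          (starRingEnd ℂ) (φ i d)) m t 1) ^ 2 ^ p).trace.re} ≤
      ENNReal.ofReal (Real.exp (-2 ^ p) * s) := by
  set γ := 3 / (m : ℝ) with hγ
  have hγ0 : 0 ≤ γ := by positivity
  have has : ∀ d, ‖restrictVec Δ fun i => (starRingEnd ℂ) (φ i d)‖ ^ 2 ≤ s := fun d =>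
    norm_restrictVec_sq_le hΔs fun i => by rw [RCLike.norm_conj]; exact hφ i d
  refine (measure_trace_iterRun_ge_le hγ0 hs (measurable_restrictVec hφm Δ) has μ
    (fun i j => ?_) p hp m (by positivity)).trans (ENNReal.ofReal_le_ofReal ?_)
  · have h1 : ∀ d, star ((restrictVec Δ fun i => (starRingEnd ℂ) (φ i d)) i) *
        (restrictVec Δ fun i => (starRingEnd ℂ) (φ i d)) j =
        (starRingEnd ℂ) (φ j d) * φ i d := fun d => by
      simp [restrictVec, mul_comm]
    simp only [h1, hort, Subtype.ext_iff, eq_comm]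
  have hcard : (Fintype.card Δ : ℝ) ≤ s := by
    rw [Fintype.card_coe, ← nsmul_one, ← Finset.sum_const]
    exact (Finset.sum_le_sum fun i _ => one_le_pow₀ (hw i)).trans hΔs
  have h1 : (1 - γ * 2 ^ p) ^ m ≤ Real.exp (-(3 * 2 ^ p)) := by
    calc _ ≤ Real.exp (-(γ * 2 ^ p)) ^ m := by
          refine pow_le_pow_left₀ ?_ ?_ m
          · nlinarith [mul_nonneg hγ0 (show (0 : ℝ) ≤ 2 ^ p by positivity)]
          · linarith [Real.add_one_le_exp (-(γ * 2 ^ p))]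
      _ = _ := by
          rw [← Real.exp_nat_mul, hγ]
          congr 1
          field_simp
  have h2 : (4 : ℝ) ^ 2 ^ p ≤ Real.exp (2 * 2 ^ p) := by
    calc (4 : ℝ) ^ 2 ^ p ≤ Real.exp 2 ^ 2 ^ p := by
          gcongr
          have h3 : Real.exp 2 = Real.exp 1 * Real.exp 1 := by
            rw [← Real.exp_add]; norm_num
          rw [h3]
          nlinarith [Real.add_one_le_exp (1 : ℝ)]
      _ = _ := by
          rw [← Real.exp_nat_mul]
          congr 1
          push_cast
          ring
  calc _ = (1 - γ * 2 ^ p) ^ m * Fintype.card Δ * 4 ^ 2 ^ p := by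
        rw [one_div, inv_pow, div_inv_eq_mul]
    _ ≤ Real.exp (-(3 * 2 ^ p)) * s * Real.exp (2 * 2 ^ p) := by gcongr
    _ = Real.exp (-2 ^ p) * s := by
        rw [show -2 ^ p = -(3 * 2 ^ p) + (2 : ℝ) * 2 ^ p by ring, Real.exp_add]; ring

theorem measure_dualCertificate_ge (hw : ∀ i, 1 ≤ w i) (hφm : ∀ i, Measurable (φ i))
    (hφ : ∀ i d, ‖φ i d‖ ≤ w i)
    (hort : ∀ i j, (∫ d, (starRingEnd ℂ) (φ i d) * φ j d ∂μ) = if i = j then 1 else 0)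
    {IK Δ : Finset I} (hIK : 1 ≤ IK.card) {s ε : ℝ} (hs : 1 ≤ s)
    (hΔs : ∑ i ∈ Δ, w i ^ 2 ≤ s) {m : ℕ} (hm : 12 * s ≤ m) (hε0 : 0 < ε)
    (hε : Real.exp (-(m / (1152 * s))) ≤ ε / (48 * IK.card * s)) (x : I → ℂ) :
    1 - ENNReal.ofReal ε ≤ (Measure.pi fun _ : Fin m => μ) {t |
      ∃ (q : Fin m → ℂ) (r : EuclideanSpace ℂ Δ),
        (restrictVec Δ (weightedSign w x) - r =
          ∑ k, q k • restrictVec Δ fun i => (starRingEnd ℂ) (φ i (t k))) ∧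
        (∑ k, ‖q k‖ ^ 2 ≤ 16 * s / m) ∧ ‖r‖ ≤ 1 / 16 ∧
        (∀ i ∈ IK \ Δ, ‖∑ k, q k * (starRingEnd ℂ) (φ i (t k))‖ ≤ w i / 2) ∧
        ∀ z, ‖z‖ ^ 2 ≤ 12 / m *
          ∑ k, ‖inner ℂ (restrictVec Δ fun i => (starRingEnd ℂ) (φ i (t k))) z‖ ^ 2} := by
  have hs0 : 0 < s := by linarith
  have hm0 : (0 : ℝ) < m := by linarith
  have hN : (1 : ℝ) ≤ IK.card := by exact_mod_cast hIK
  have hw0 : ∀ i, 0 < w i := fun i => one_pos.trans_le (hw i)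
  have hrs : 1 ≤ Real.sqrt s := Real.one_le_sqrt.2 hs
  have hrrs : Real.sqrt s * Real.sqrt s = s := Real.mul_self_sqrt hs0.le
  set a := fun d => restrictVec Δ fun i => (starRingEnd ℂ) (φ i d) with ha
  have ham : Measurable a := measurable_restrictVec hφm Δ
  have has : ∀ d, ‖a d‖ ^ 2 ≤ s := fun d =>
    norm_restrictVec_sq_le hΔs fun i => by rw [RCLike.norm_conj]; exact hφ i d
  set z₀ := restrictVec Δ (weightedSign w x) with hz₀
  have hz₀s : ‖z₀‖ ≤ Real.sqrt s :=
    Real.le_sqrt_of_sq_le (norm_restrictVec_sq_le hΔs (norm_weightedSign_le hw0 x))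
  set κ := (m : ℝ) / (8 * s) with hκ
  have hκ0 : 0 < κ := by positivity
  set E := Real.exp (-(m / (1152 * s))) with hE
  have hE0 : 0 < E := Real.exp_pos _
  have hEN : E * (48 * IK.card * s) ≤ ε := (le_div_iff₀ (by positivity)).1 hε
  have hEs : E * s ≤ E * (IK.card * s) := by
    gcongr; exact le_mul_of_one_le_left hs0.le hN
  have hEN' : E * IK.card ≤ E * (IK.card * s) := by
    gcongr; exact le_mul_of_one_le_right (by positivity) hs
  obtain ⟨p, hp1, hp2⟩ := exists_nat_pow_near (show 1 ≤ (m : ℝ) / (12 * s) by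
    rwa [le_div_iff₀ (by positivity), one_mul]) one_lt_two
  set γ := 3 / (m : ℝ) with hγ
  have hγ0 : 0 ≤ γ := by positivity
  have hγp : γ * s * (2 * 2 ^ p) ≤ 1 / 2 := by
    calc _ ≤ γ * s * (2 * ((m : ℝ) / (12 * s))) := by gcongr
      _ = 1 / 2 := by rw [hγ]; field_simp; norm_num
  have hγs : γ * s ≤ 1 := by
    have h1 : (1 : ℝ) ≤ 2 ^ p := one_le_pow₀ one_le_two
    nlinarith [mul_nonneg hγ0 hs0.le]
  -- The bad events.
  set A : Set (Fin m → D) := {t | 1 / 16 ≤ ‖iterRun (kaczmarzUpdate s κ a) m t z₀‖} with hA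
  set B : I → Set (Fin m → D) := fun i => {t | w i / 2 < ‖∑ k, kaczmarzCoeff s κ a m t z₀ k *
    (starRingEnd ℂ) (φ i (t k))‖} with hB
  set F : Set (Fin m → D) := {t | (1 / 4) ^ 2 ^ p ≤
    (((iterRun (downUpdate γ a) m t 1).conjTranspose *
    iterRun (downUpdate γ a) m t 1) ^ 2 ^ p).trace.re} with hF
  have hAp : (Measure.pi fun _ : Fin m => μ) A ≤ ENNReal.ofReal (16 * (E * s)) := by
    refine (measure_kaczmarz_norm_ge_le hs hκ0 ham has μ
      (integral_norm_inner_restrictVec_sq hφm hφ hort Δ) m z₀ (by norm_num)).trans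
      (ENNReal.ofReal_le_ofReal ?_)
    have h1 : (1 - 1 / (4 * s)) ^ m ≤ Real.exp (-(2 * κ)) := by
      calc _ ≤ Real.exp (-(1 / (4 * s))) ^ m := by
            refine pow_le_pow_left₀ ?_ ?_ m
            · rw [sub_nonneg, div_le_one (by positivity)]; linarith
            · linarith [Real.add_one_le_exp (-(1 / (4 * s)))]
        _ = _ := by
            rw [← Real.exp_nat_mul, hκ]
            congr 1
            field_simp
            norm_num
    have h2 : κ / Real.sqrt s * ‖z₀‖ ≤ κ := by
      calc _ ≤ κ / Real.sqrt s * Real.sqrt s := by gcongr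
        _ = κ := by field_simp
    calc _ ≤ Real.exp (-(2 * κ)) * (Real.sqrt s * Real.exp κ) / (1 / 16) := by gcongr
      _ = 16 * (Real.exp (-κ) * Real.sqrt s) := by
          rw [show -κ = -(2 * κ) + κ by ring, Real.exp_add]; ring
      _ ≤ 16 * (E * s) := by
          gcongr
          · refine Real.exp_le_exp.2 (neg_le_neg ?_)
            rw [hκ]
            gcongr
            norm_num
          · nlinarith
  have hBp : ∀ i ∈ IK \ Δ, (Measure.pi fun _ : Fin m => μ) (B i) ≤ ENNReal.ofReal (4 * E) := by
    intro i hi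
    refine (measure_kaczmarz_offSupport_le hw hφm hφ hort hs hκ0 hΔs m z₀ hz₀s
      (Finset.mem_sdiff.1 hi).2).trans (le_of_eq ?_)
    rw [hκ, hE, div_div]
    ring_nf
  have hFp : (Measure.pi fun _ : Fin m => μ) F ≤ ENNReal.ofReal (E * s) := by
    refine (measure_trace_iterRun_restrictVec_le hw hφm hφ hort hs hΔs hm0 hγp).trans
      (ENNReal.ofReal_le_ofReal ?_)
    gcongr
    refine Real.exp_le_exp.2 (neg_le_neg ?_)
    have h3 : (m : ℝ) / (12 * s) = 2 * (m / (24 * s)) := by field_simp; norm_num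
    rw [pow_succ, h3] at hp2
    have h4 : (m : ℝ) / (1152 * s) ≤ m / (24 * s) := by gcongr; norm_num
    linarith
  have hsub : (A ∪ ((⋃ i ∈ IK \ Δ, B i) ∪ F))ᶜ ⊆ {t |
      ∃ (q : Fin m → ℂ) (r : EuclideanSpace ℂ Δ), (z₀ - r = ∑ k, q k • a (t k)) ∧
        (∑ k, ‖q k‖ ^ 2 ≤ 16 * s / m) ∧ ‖r‖ ≤ 1 / 16 ∧
        (∀ i ∈ IK \ Δ, ‖∑ k, q k * (starRingEnd ℂ) (φ i (t k))‖ ≤ w i / 2) ∧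
        ∀ z, ‖z‖ ^ 2 ≤ 12 / m * ∑ k, ‖inner ℂ (a (t k)) z‖ ^ 2} := by
    intro t ht
    simp only [Set.mem_compl_iff, Set.mem_union, Set.mem_iUnion, not_or, not_exists, hA, hB, hF,
      Set.mem_ofPred_eq, not_le, not_lt] at ht
    refine ⟨kaczmarzCoeff s κ a m t z₀, iterRun (kaczmarzUpdate s κ a) m t z₀,
      sub_iterRun_kaczmarz s κ a m t z₀, ?_, ht.1.le, ht.2.1, fun z => ?_⟩
    · refine (sum_kaczmarzCoeff_sq_le hs0 hκ0 has m t z₀).trans ?_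
      calc _ ≤ 2 / (Real.sqrt s * κ) * Real.sqrt s := by gcongr
        _ = _ := by rw [hκ]; field_simp; norm_num
    · refine (norm_sq_le_sum_inner_sq hγ0 hγs has m t p ht.2.2 z).trans (le_of_eq ?_)
      rw [hγ]
      ring
  have htot : (Measure.pi fun _ : Fin m => μ) (A ∪ ((⋃ i ∈ IK \ Δ, B i) ∪ F)) ≤
      ENNReal.ofReal ε := by
    calc _ ≤ ENNReal.ofReal (16 * (E * s)) + (∑ i ∈ IK \ Δ, ENNReal.ofReal (4 * E) +
          ENNReal.ofReal (E * s)) := by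
          refine (measure_union_le _ _).trans (add_le_add hAp ?_)
          refine (measure_union_le _ _).trans (add_le_add ?_ hFp)
          exact (measure_biUnion_finset_le _ _).trans (Finset.sum_le_sum hBp)
      _ ≤ ENNReal.ofReal (16 * (E * s)) + (ENNReal.ofReal (IK.card * (4 * E)) +
          ENNReal.ofReal (E * s)) := by
          gcongr
          rw [Finset.sum_const, nsmul_eq_mul, ENNReal.ofReal_mul (Nat.cast_nonneg IK.card),
            ENNReal.ofReal_natCast]
          gcongr
          exact Finset.sdiff_subset
      _ ≤ ENNReal.ofReal ε := by
          rw [← ENNReal.ofReal_add (by positivity) (by positivity),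
            ← ENNReal.ofReal_add (by positivity) (by positivity)]
          refine ENNReal.ofReal_le_ofReal ?_
          nlinarith
  exact one_sub_le_measure_of_compl_subset hsub htot

end Probability

theorem exp_neg_le_of_sample_bound {s ε N m : ℝ} (hs : 1 ≤ s) (hε0 : 0 < ε)
    (hε : ε < Real.exp (-1)) (hN : 1 ≤ N)
    (hm : 10000 * s * Real.log (1 / ε) * Real.log (2 * N * Real.sqrt s) ≤ m) :
    12 * s ≤ m ∧ Real.exp (-(m / (1152 * s))) ≤ ε / (48 * N * s) := by
  have hs0 : 0 < s := by linarith
  have hrs : 1 ≤ Real.sqrt s := Real.one_le_sqrt.2 hs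
  have hlogε : Real.log (1 / ε) = -Real.log ε := by rw [one_div, Real.log_inv]
  have hL : 1 ≤ Real.log (1 / ε) := by
    have := Real.log_lt_log hε0 hε
    rw [Real.log_exp] at this
    linarith
  have hΛ : 0.69 ≤ Real.log (2 * N * Real.sqrt s) := by
    have h1 : Real.log 2 ≤ Real.log (2 * N * Real.sqrt s) := by
      refine Real.log_le_log (by norm_num) ?_
      nlinarith
    linarith [Real.log_two_gt_d9]
  have hexpL : Real.exp (-Real.log (1 / ε)) = ε := by
    rw [hlogε, neg_neg, Real.exp_log hε0]
  have hexpΛ : Real.exp (Real.log (2 * N * Real.sqrt s)) = 2 * N * Real.sqrt s :=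
    Real.exp_log (by positivity)
  set L := Real.log (1 / ε)
  set Λ := Real.log (2 * N * Real.sqrt s)
  have hLΛ : 0.69 ≤ L * Λ := by nlinarith
  have hm1 : 10000 * (L * Λ) * s ≤ m := by linarith
  refine ⟨?_, ?_⟩
  · nlinarith
  have h1 : L + 6 * Λ ≤ m / (1152 * s) := by
    rw [le_div_iff₀ (by positivity)]
    have h2 : L + 6 * Λ ≤ 8 * (L * Λ) := by nlinarith
    nlinarith
  calc Real.exp (-(m / (1152 * s))) ≤ Real.exp (-(L + 6 * Λ)) := by gcongr
    _ = ε / (2 * N * Real.sqrt s) ^ 6 := by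
        rw [neg_add, Real.exp_add, hexpL, Real.exp_neg, ← hexpΛ, ← Real.exp_nat_mul]
        norm_num [div_eq_mul_inv]
    _ ≤ ε / (48 * N * s) := by
        gcongr
        have h2 : (2 * N * Real.sqrt s) ^ 6 = 64 * N ^ 6 * s ^ 3 := by
          calc _ = 64 * N ^ 6 * (Real.sqrt s ^ 2) ^ 3 := by ring
            _ = _ := by rw [Real.sq_sqrt hs0.le]
        rw [h2]
        gcongr
        · norm_num
        · exact le_self_pow₀ hN (by norm_num)
        · exact le_self_pow₀ hs (by norm_num)

/-- Corollary 5.3 (weighted sparsity recovery guarantee).  There are universal constants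
`c₀, C > 0` such that for `μ = ν` (so `u_i = max{1, sup|φ_i|}`), weights `w ≥ u`, `s ≥ 1`,
`0 < ε < e⁻¹` and `m ≥ c₀·s·log(ε⁻¹)·log(2N√s)`, with probability at least `1 − ε`, every
minimizer `x̂` of the truncated weighted ℓ¹ problem satisfies
`‖x − x̂‖₂ ≤ C(λ√s(η/√m + ‖x−P_Kx‖_{1,u}) + σ_{s,K}(x)_{1,w} + T_{K,w}(x))`
(the terms `σ_{s,K}` and `T_{K,w}`, both minima, are encoded by quantifying over all
admissible `Δ` and all feasible `x̄`). -/
theorem stmt3 : ∃ c₀ C : ℝ, 0 < c₀ ∧ 0 < C ∧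
    ∀ (D : Type) [MeasurableSpace D] (I : Type) [DecidableEq I] [Countable I]
      (μ : Measure D) [IsProbabilityMeasure μ]
      (φ : I → D → ℂ), (∀ i, Measurable (φ i)) →
    (∀ i j : I, (∫ s, (starRingEnd ℂ) (φ i s) * φ j s ∂μ) = if i = j then 1 else 0) →
    ∀ u : I → ℝ, (∀ i, 1 ≤ u i) → (∀ i s, ‖φ i s‖ ≤ u i) →
    ∀ w : I → ℝ, (∀ i, 0 < w i) → (∀ i, u i ≤ w i) →
    ∀ IK : Finset I,
    ∀ x : I → ℂ, (Summable fun i => w i * ‖x i‖) →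
    ∀ s : ℝ, 1 ≤ s →
    ∀ ε : ℝ, 0 < ε → ε < Real.exp (-1) →
    ∀ η : ℝ, 0 ≤ η →
    ∀ m : ℕ,
    c₀ * s * Real.log (1 / ε) * Real.log (2 * IK.card * Real.sqrt s) ≤ m →
    1 - ENNReal.ofReal ε ≤
      (Measure.pi fun _ : Fin m => μ) {t : Fin m → D |
        ∀ e : Fin m → ℂ, l2m e ≤ η →
        ∀ xh : I → ℂ, (∀ i ∉ IK, xh i = 0) →
          l2m (fun k => Uapp0 φ t xh k - (Uapp0 φ t x k + e k)) ≤ η →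
          (∀ z : I → ℂ, (∀ i ∉ IK, z i = 0) →
            l2m (fun k => Uapp0 φ t z k - (Uapp0 φ t x k + e k)) ≤ η →
            (∑' i, w i * ‖xh i‖) ≤ ∑' i, w i * ‖z i‖) →
        ∀ Δ : Finset I, Δ ⊆ IK → (∑ i ∈ Δ, w i ^ 2) ≤ s →
        ∀ xb : I → ℂ, (∀ i ∉ IK, xb i = 0) →
          l2m (fun k => Uapp0 φ t xb k - (Uapp0 φ t x k + e k)) ≤ η →
        l2I (fun i => x i - xh i) ≤
          C * ((1 + Real.sqrt (Real.log (1 / ε)) / Real.log (2 * IK.card * Real.sqrt s)) *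
              Real.sqrt s * (η / Real.sqrt m + ∑' i, u i * ‖x i - proj IK x i‖) +
            (∑' i, w i * ‖x i - proj Δ x i‖) + ∑' i, w i * ‖x i - xb i‖)} := by
  refine ⟨10000, 200, by norm_num, by norm_num, ?_⟩
  intro D _ I _ _ μ _ φ hφm hort u hu1 hφu w hw0 huw IK x hx s hs ε hε0 hε η hη m hm
  have hw : ∀ i, 1 ≤ w i := fun i => (hu1 i).trans (huw i)
  have hφ : ∀ i d, ‖φ i d‖ ≤ w i := fun i d => (hφu i d).trans (huw i)
  have hΛ : 0 ≤ Real.log (2 * IK.card * Real.sqrt s) := by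
    rcases IK.card.eq_zero_or_pos with h | h
    · simp [h]
    · have h1 : (1 : ℝ) ≤ IK.card := by exact_mod_cast h
      have h2 : 1 ≤ Real.sqrt s := Real.one_le_sqrt.2 hs
      exact Real.log_nonneg (by nlinarith)
  have hsuff : ∀ A σ T τ : ℝ, 0 ≤ τ →
      A ≤ 200 * (Real.sqrt s * (η / Real.sqrt m) + σ + T) →
      A ≤ 200 * ((1 + Real.sqrt (Real.log (1 / ε)) /
        Real.log (2 * IK.card * Real.sqrt s)) * Real.sqrt s * (η / Real.sqrt m + τ) + σ + T) := by
    intro A σ T τ hτ hA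
    refine hA.trans ?_
    have h1 : 0 ≤ Real.sqrt (Real.log (1 / ε)) / Real.log (2 * IK.card * Real.sqrt s) := by
      positivity
    have h2 : Real.sqrt s * (η / Real.sqrt m) ≤ (1 + Real.sqrt (Real.log (1 / ε)) /
        Real.log (2 * IK.card * Real.sqrt s)) * Real.sqrt s * (η / Real.sqrt m + τ) := by
      gcongr
      · exact le_mul_of_one_le_left (Real.sqrt_nonneg s) (by linarith)
      · linarith
    linarith
  have hproj : ∀ S : Finset I, 0 ≤ ∑' i, u i * ‖x i - proj S x i‖ := fun S =>
    tsum_nonneg fun i => mul_nonneg (by linarith [hu1 i]) (norm_nonneg _)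
  rcases IK.eq_empty_or_nonempty with rfl | hIK
  · refine tsub_le_self.trans (le_of_eq ?_)
    rw [← measure_univ (μ := Measure.pi fun _ : Fin m => μ)]
    congr 1
    refine (Set.eq_univ_of_forall fun t => ?_).symm
    intro e _ xh hxh _ _ Δ _ _ xb hxb _
    refine hsuff _ _ _ _ (hproj _) ?_
    have hxb0 : xb = 0 := funext fun i => hxb i (Finset.notMem_empty i)
    have hxh0 : xh = 0 := funext fun i => hxh i (Finset.notMem_empty i)
    subst hxb0 hxh0
    simp only [Pi.zero_apply, sub_zero]
    have h0 : ∀ i, 0 ≤ w i * ‖x i‖ := fun i => mul_nonneg (hw0 i).le (norm_nonneg _)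
    have h1 : l2I (fun i => x i) ≤ 0 + ∑' i, w i * ‖x i‖ :=
      l2I_le_add (p := fun _ => 0) (r := x) le_rfl (tsum_nonneg h0) (fun i => by simp)
        (fun S => by simp) fun S => (Finset.sum_le_sum fun i _ =>
          le_mul_of_one_le_left (norm_nonneg _) (hw i)).trans
            (hx.sum_le_tsum S fun i _ => h0 i)
    have h2 : 0 ≤ ∑' i, w i * ‖x i - proj Δ x i‖ :=
      tsum_nonneg fun i => mul_nonneg (hw0 i).le (norm_nonneg _)
    have h3 : 0 ≤ Real.sqrt s * (η / Real.sqrt m) := by positivity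
    have h4 : 0 ≤ ∑' i, w i * ‖x i‖ := tsum_nonneg h0
    linarith
  · have hN : 1 ≤ IK.card := hIK.card_pos
    obtain ⟨hm12, hexp⟩ := exp_neg_le_of_sample_bound hs hε0 hε (by exact_mod_cast hN) hm
    have hm0 : 0 < m := by
      have : (0 : ℝ) < m := by linarith
      exact_mod_cast this
    obtain ⟨Δ₀, hΔ₀, hmin⟩ := Finset.exists_min_image
      (IK.powerset.filter fun Δ => ∑ i ∈ Δ, w i ^ 2 ≤ s)
      (fun Δ => ∑' i, w i * ‖x i - proj Δ x i‖)
      ⟨∅, by simp only [Finset.mem_filter, Finset.empty_mem_powerset, Finset.sum_empty]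
             exact ⟨trivial, by linarith⟩⟩
    obtain ⟨hΔIK, hΔs⟩ := Finset.mem_filter.1 hΔ₀
    rw [Finset.mem_powerset] at hΔIK
    refine (measure_dualCertificate_ge hw hφm hφ hort hN hs hΔs hm12 hε0 hexp x).trans
      (measure_mono ?_)
    rintro t ⟨q, r, hdec, hq, hr, hoff, hlow⟩
    intro e _ xh hxh hxhη hxhmin Δ hΔ hΔw xb hxb hxbη
    refine hsuff _ _ _ _ (hproj _) ?_
    have h1 := l2I_sub_le_of_dualCertificate hw hφ hm0 t hΔIK hs hx hdec hq hr hoff hlow hη hxh hxb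
      hxhη hxbη (hxhmin xb hxb hxbη)
    have h2 := hmin Δ (Finset.mem_filter.2 ⟨Finset.mem_powerset.2 hΔ, hΔw⟩)
    linarith
end

section
/- Let d, K ∈ ℕ, define u : ℕ₀^d → ℝ by u_i := 2^{|i|₀/2}, and let I_K = I_K^{TD} := {i ∈ ℕ₀^d : |i|₁ ≤ K} be the total degree index set. Then for every s ≥ 1 and every nonempty Δ ⊊ I_K with |Δ| ≤ s, one has M(Δ; u, 1) := |Δ|_u + (max_{i∈I_K∖Δ} u_i²)·max{|Δ|, 1} ≤ 2^{min{d,K}+1}·s. -/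
open scoped BigOperators

/-- `|i|₀`: the number of nonzero entries of a multi-index `i ∈ ℕ₀^d`. -/
def zeroNorm {d : ℕ} (i : Fin d → ℕ) : ℕ := (Finset.univ.filter fun j => i j ≠ 0).card

theorem zeroNorm_le_dim {d : ℕ} (i : Fin d → ℕ) : zeroNorm i ≤ d :=
  (Finset.card_filter_le _ _).trans (by simp)

theorem zeroNorm_le_sum {d : ℕ} (i : Fin d → ℕ) : zeroNorm i ≤ ∑ j, i j := by
  rw [zeroNorm, Finset.card_filter]
  refine Finset.sum_le_sum fun j _ => ?_
  split_ifs <;> omega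

/-- Tensor Chebyshev polynomials with Chebyshev sampling, unweighted case: for the weights
`u_i = 2^{|i|₀/2}` (so `u_i² = 2^{|i|₀}`), the total degree set `I_K^{TD}`, and any nonempty
`Δ ⊊ I_K^{TD}` with `|Δ| ≤ s`, one has
`M(Δ;u,1) = |Δ|_u + (max_{i∈I_K∖Δ} u_i²)·max{|Δ|,1} ≤ 2^{min{d,K}+1}·s`. -/
theorem stmt6 (d K : ℕ) (IK : Finset (Fin d → ℕ))
    (hIK : ∀ i : Fin d → ℕ, i ∈ IK ↔ ∑ j, i j ≤ K)
    (s : ℝ) (hs : 1 ≤ s)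
    (Δ : Finset (Fin d → ℕ)) (hne : Δ.Nonempty) (hssub : Δ ⊂ IK)
    (hcard : (Δ.card : ℝ) ≤ s) :
    (∑ i ∈ Δ, (2 : ℝ) ^ zeroNorm i) +
        ((IK \ Δ).sup' (Finset.sdiff_nonempty.mpr hssub.not_subset)
            fun i => (2 : ℝ) ^ zeroNorm i) * max (Δ.card : ℝ) 1 ≤
      2 ^ (min d K + 1) * s := by
  have hbound : ∀ i ∈ IK, (2 : ℝ) ^ zeroNorm i ≤ 2 ^ min d K := fun i hi =>
    pow_le_pow_right₀ one_le_two
      (le_min (zeroNorm_le_dim i) ((zeroNorm_le_sum i).trans ((hIK i).1 hi)))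
  have hsum : ∑ i ∈ Δ, (2 : ℝ) ^ zeroNorm i ≤ 2 ^ min d K * s := by
    calc ∑ i ∈ Δ, (2 : ℝ) ^ zeroNorm i ≤ Δ.card • (2 : ℝ) ^ min d K :=
          Finset.sum_le_card_nsmul _ _ _ fun i hi => hbound i (hssub.subset hi)
      _ = 2 ^ min d K * Δ.card := by rw [nsmul_eq_mul, mul_comm]
      _ ≤ 2 ^ min d K * s := by gcongr
  have hsup : (IK \ Δ).sup' (Finset.sdiff_nonempty.mpr hssub.not_subset)
      (fun i => (2 : ℝ) ^ zeroNorm i) ≤ 2 ^ min d K :=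
    Finset.sup'_le _ _ fun i hi => hbound i (Finset.mem_sdiff.1 hi).1
  have hmul := mul_le_mul hsup (max_le hcard hs)
    (zero_le_one.trans (le_max_right (Δ.card : ℝ) 1)) (by positivity)
  rw [pow_succ]
  linarith
end

section
/- Let d ∈ ℕ and define u : ℕ₀^d → ℝ by u_i := 2^{|i|₀/2}. Then for every s ≥ 1, every nonempty finite lower set Δ ⊆ ℕ₀^d with |Δ| ≤ s, and every finite set I_K ⊆ ℕ₀^d with Δ ⊊ I_K, one has M(Δ; u, u) = |Δ|_u + max{|Δ|_u, 1} ≤ 2·s^{log 3 / log 2}. In particular, Σ_{i∈Δ} 2^{|i|₀} ≤ |Δ|^{log 3 / log 2} for every nonempty finite lower set Δ. -/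
open scoped BigOperators

/-- A finite set `Δ ⊆ ℕ₀^d` is lower (downwards closed). -/
def IsLowerIndexSet {d : ℕ} (Δ : Finset (Fin d → ℕ)) : Prop :=
  ∀ i ∈ Δ, ∀ i' : Fin d → ℕ, (∀ j, i' j ≤ i j) → i' ∈ Δ

lemma two_rpow_log_three_div_log_two : (2 : ℝ) ^ (Real.log 3 / Real.log 2) = 3 := by
  have h2 : Real.log 2 ≠ 0 := (Real.log_pos one_lt_two).ne'
  rw [Real.rpow_def_of_pos two_pos, mul_div_cancel₀ _ h2, Real.exp_log three_pos]

lemma one_le_log_three_div_log_two : 1 ≤ Real.log 3 / Real.log 2 := by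
  rw [one_le_div (Real.log_pos one_lt_two)]
  exact Real.log_le_log two_pos (by norm_num)

/-- Superadditivity with gain: since `2 ^ (log 3 / log 2) = 3`, convexity of the power function
gives a factor `2` on the smaller summand. -/
lemma rpow_add_two_mul_rpow_le {a b : ℝ} (hb : 0 ≤ b) (hba : b ≤ a) :
    a ^ (Real.log 3 / Real.log 2) + 2 * b ^ (Real.log 3 / Real.log 2) ≤
      (a + b) ^ (Real.log 3 / Real.log 2) := by
  have hα := one_le_log_three_div_log_two
  rcases (hb.trans hba).eq_or_lt with ha | ha
  · obtain rfl : b = 0 := le_antisymm (ha ▸ hba) hb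
    rw [Real.zero_rpow (by positivity)]
    simp
  have hconv := (convexOn_rpow hα).2 (Set.mem_Ici.2 hb) (Set.mem_Ici.2 (add_nonneg ha.le hb))
  have ht : 0 ≤ (a - b) / a := div_nonneg (sub_nonneg.2 hba) ha.le
  have ht' : 0 ≤ b / a := div_nonneg hb ha.le
  have h₁ := hconv ht' ht (by field_simp; ring)
  have h₂ := hconv ht ht' (by field_simp; ring)
  simp only [smul_eq_mul] at h₁ h₂
  rw [show b / a * b + (a - b) / a * (a + b) = a by field_simp; ring] at h₁
  rw [show (a - b) / a * b + b / a * (a + b) = 2 * b by field_simp; ring,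
    Real.mul_rpow zero_le_two hb, two_rpow_log_three_div_log_two] at h₂
  have hsum : (a - b) / a = 1 - b / a := by field_simp
  rw [hsum] at h₁ h₂
  linarith

lemma zeroNorm_eq_succ_zeroNorm_update {d : ℕ} (i : Fin d → ℕ) {j : Fin d} (hj : i j ≠ 0) :
    zeroNorm i = zeroNorm (Function.update i j 0) + 1 := by
  unfold zeroNorm
  have h : (Finset.univ.filter fun k => Function.update i j 0 k ≠ 0) =
      (Finset.univ.filter fun k => i k ≠ 0).erase j := by
    ext k
    by_cases hk : k = j <;> simp [Function.update_apply, hk]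
  rw [h, Finset.card_erase_add_one (by simpa using hj)]

/-- The top slice of `Δ` in direction `j`, projected onto `i j = 0`, is lower. -/
lemma IsLowerIndexSet.image_update_filter {d : ℕ} {Δ : Finset (Fin d → ℕ)}
    (hlow : IsLowerIndexSet Δ) (j : Fin d) (k : ℕ) :
    IsLowerIndexSet ((Δ.filter fun i => i j = k).image fun i => Function.update i j 0) := by
  intro i hi i' hle
  simp only [Finset.mem_image, Finset.mem_filter] at hi ⊢
  obtain ⟨x, ⟨hx, hxk⟩, rfl⟩ := hi
  have hj : i' j = 0 := by simpa using hle j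
  refine ⟨Function.update i' j k, ⟨hlow x hx _ fun l => ?_, by simp⟩, by simp [← hj]⟩
  rcases eq_or_ne l j with rfl | hl
  · simp [hxk]
  · simpa [hl] using hle l

lemma IsLowerIndexSet.filter_apply_lt {d : ℕ} {Δ : Finset (Fin d → ℕ)}
    (hlow : IsLowerIndexSet Δ) (j : Fin d) (k : ℕ) :
    IsLowerIndexSet (Δ.filter fun i => i j < k) := by
  intro i hi i' hle
  rw [Finset.mem_filter] at hi ⊢
  exact ⟨hlow i hi.1 i' hle, (hle j).trans_lt hi.2⟩

theorem IsLowerIndexSet.sum_two_pow_zeroNorm_le {d : ℕ} {Δ : Finset (Fin d → ℕ)}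
    (hlow : IsLowerIndexSet Δ) :
    ∑ i ∈ Δ, (2 : ℝ) ^ zeroNorm i ≤ (Δ.card : ℝ) ^ (Real.log 3 / Real.log 2) := by
  induction hn : Δ.card using Nat.strong_induction_on generalizing Δ with
  | _ n ih =>
  subst hn
  by_cases hzero : ∀ i ∈ Δ, i = 0
  · have hsub : Δ ⊆ {0} := fun i hi => Finset.mem_singleton.2 (hzero i hi)
    rcases Finset.subset_singleton_iff.1 hsub with rfl | rfl
    · simpa using Real.rpow_nonneg le_rfl _
    · simp [zeroNorm]
  push Not at hzero
  obtain ⟨i₀, hi₀, hne⟩ := hzero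
  obtain ⟨j, hj⟩ := Function.ne_iff.1 hne
  obtain ⟨m, hm, hmax⟩ := Δ.exists_max_image (fun i => i j) ⟨i₀, hi₀⟩
  have hk : m j ≠ 0 := ((Nat.pos_of_ne_zero hj).trans_le (hmax i₀ hi₀)).ne'
  set A := Δ.filter fun i => i j < m j
  set B := Δ.filter fun i => i j = m j
  set B' := B.image fun i => Function.update i j 0 with hB'
  have hnot : (Δ.filter fun i => ¬ i j < m j) = B :=
    Finset.filter_congr fun i hi => by have := hmax i hi; omega
  have hinj : Set.InjOn (fun i : Fin d → ℕ => Function.update i j 0) B := by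
    intro x hx y hy hxy
    have hxm := (Finset.mem_filter.1 hx).2
    have hym := (Finset.mem_filter.1 hy).2
    ext l
    rcases eq_or_ne l j with rfl | hl
    · rw [hxm, hym]
    · simpa [hl] using congrFun hxy l
  have hcardB : B'.card = B.card := Finset.card_image_of_injOn hinj
  have hsub : B' ⊆ A := by
    intro x hx
    obtain ⟨y, hy, rfl⟩ := Finset.mem_image.1 hx
    refine Finset.mem_filter.2 ⟨hlow y (Finset.mem_filter.1 hy).1 _ fun l => ?_, by
      simpa using Nat.pos_of_ne_zero hk⟩
    rcases eq_or_ne l j with rfl | hl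
    · simp
    · simp [hl]
  have hle : B.card ≤ A.card := hcardB ▸ Finset.card_le_card hsub
  have hpos : 0 < B.card := Finset.card_pos.2 ⟨m, Finset.mem_filter.2 ⟨hm, rfl⟩⟩
  have hcard : A.card + B.card = Δ.card := by
    rw [← hnot]
    exact Finset.card_filter_add_card_filter_not _
  have hsumB : ∑ i ∈ B, (2 : ℝ) ^ zeroNorm i = 2 * ∑ i ∈ B', (2 : ℝ) ^ zeroNorm i := by
    rw [hB', Finset.sum_image hinj, Finset.mul_sum]
    refine Finset.sum_congr rfl fun i hi => ?_
    have hij : i j ≠ 0 := (Finset.mem_filter.1 hi).2 ▸ hk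
    rw [zeroNorm_eq_succ_zeroNorm_update i hij, pow_succ']
  have ihA := ih A.card (by omega) (hlow.filter_apply_lt j (m j)) rfl
  have ihB := ih B'.card (by omega) (hlow.image_update_filter j (m j)) rfl
  rw [hcardB] at ihB
  rw [← Finset.sum_filter_add_sum_filter_not Δ (fun i => i j < m j), hnot, hsumB, ← hcard,
    Nat.cast_add]
  exact (add_le_add ihA (mul_le_mul_of_nonneg_left ihB zero_le_two)).trans
    (rpow_add_two_mul_rpow_le (Nat.cast_nonneg _) (Nat.cast_le.2 hle))

/-- Tensor Chebyshev polynomials, weighted case `w = u` with `u_i = 2^{|i|₀/2}`: for every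
nonempty finite lower set `Δ` with `|Δ| ≤ s` and any finite `I_K ⊋ Δ`, one has
`M(Δ;u,u) = |Δ|_u + max{|Δ|_u,1} ≤ 2 s^{log 3/log 2}`; in particular
`Σ_{i∈Δ} 2^{|i|₀} ≤ |Δ|^{log 3/log 2}`. -/
theorem stmt7 (d : ℕ) (u : (Fin d → ℕ) → ℝ)
    (hu : ∀ i, u i = Real.sqrt 2 ^ zeroNorm i)
    (s : ℝ) (hs : 1 ≤ s)
    (Δ : Finset (Fin d → ℕ)) (hne : Δ.Nonempty) (hlow : IsLowerIndexSet Δ)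
    (hcard : (Δ.card : ℝ) ≤ s)
    (IK : Finset (Fin d → ℕ)) (hssub : Δ ⊂ IK) :
    ((∑ i ∈ Δ, u i ^ 2) +
        ((IK \ Δ).sup' (Finset.sdiff_nonempty.mpr hssub.not_subset)
            fun i => u i ^ 2 / u i ^ 2) * max (∑ i ∈ Δ, u i ^ 2) 1 =
      (∑ i ∈ Δ, u i ^ 2) + max (∑ i ∈ Δ, u i ^ 2) 1) ∧
    (∑ i ∈ Δ, u i ^ 2) + max (∑ i ∈ Δ, u i ^ 2) 1 ≤
      2 * s ^ (Real.log 3 / Real.log 2) ∧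
    ∑ i ∈ Δ, (2 : ℝ) ^ zeroNorm i ≤ (Δ.card : ℝ) ^ (Real.log 3 / Real.log 2) := by
  have hsq : ∀ i, u i ^ 2 = 2 ^ zeroNorm i := fun i => by
    rw [hu, ← pow_mul, mul_comm, pow_mul, Real.sq_sqrt zero_le_two]
  have hmain := hlow.sum_two_pow_zeroNorm_le
  have hα : 0 ≤ Real.log 3 / Real.log 2 := zero_le_one.trans one_le_log_three_div_log_two
  refine ⟨?_, ?_, hmain⟩
  · have hone : ∀ i, u i ^ 2 / u i ^ 2 = 1 := fun i =>
      div_self (by rw [hsq]; positivity)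
    simp only [hone, Finset.sup'_const, one_mul]
  · simp only [hsq]
    have hs₁ := hmain.trans (Real.rpow_le_rpow (Nat.cast_nonneg _) hcard hα)
    have hs₂ := max_le hs₁ (Real.one_le_rpow hs hα)
    linarith
end

section
/- Let d, K ∈ ℕ, define u : ℕ₀^d → ℝ by u_i := Π_{j=1}^d √(2 i_j + 1), and let I_K = I_K^{TD} := {i ∈ ℕ₀^d : |i|₁ ≤ K} be the total degree index set. Then for every s ≥ 1 and every nonempty Δ ⊊ I_K with |Δ| ≤ s, one has M(Δ; u, 1) := |Δ|_u + (max_{i∈I_K∖Δ} u_i²)·max{|Δ|, 1} ≤ 2·3^K·s. -/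
open scoped BigOperators

/-- The squared sup-norm of a tensor Legendre polynomial of total degree at most `K` is at most
`3 ^ K`. -/
theorem prod_sqrt_two_mul_add_one_sq_le {ι : Type*} [Fintype ι] {K : ℕ} {i : ι → ℕ}
    (hi : ∑ j, i j ≤ K) : (∏ j, Real.sqrt (2 * (i j : ℝ) + 1)) ^ 2 ≤ 3 ^ K := by
  calc (∏ j, Real.sqrt (2 * (i j : ℝ) + 1)) ^ 2
      = ∏ j, (2 * (i j : ℝ) + 1) := by
        rw [← Finset.prod_pow]
        exact Finset.prod_congr rfl fun j _ => Real.sq_sqrt (by positivity)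
    _ ≤ ∏ j, (3 : ℝ) ^ i j := by
        refine Finset.prod_le_prod (fun j _ => by positivity) fun j _ => ?_
        have h := one_add_mul_le_pow (show (-2 : ℝ) ≤ 2 by norm_num) (i j)
        norm_num at h
        linarith
    _ = 3 ^ ∑ j, i j := Finset.prod_pow_eq_pow_sum _ _ _
    _ ≤ 3 ^ K := pow_le_pow_right₀ (by norm_num) hi

/-- Tensor Legendre polynomials with uniform sampling, unweighted case: for the weights
`u_i = Π_j √(2 i_j + 1)`, the total degree set `I_K^{TD}`, and any nonempty `Δ ⊊ I_K^{TD}`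
with `|Δ| ≤ s`, one has
`M(Δ;u,1) = |Δ|_u + (max_{i∈I_K∖Δ} u_i²)·max{|Δ|,1} ≤ 2·3^K·s`. -/
theorem stmt8 (d K : ℕ) (u : (Fin d → ℕ) → ℝ)
    (hu : ∀ i, u i = ∏ j, Real.sqrt (2 * (i j : ℝ) + 1))
    (IK : Finset (Fin d → ℕ))
    (hIK : ∀ i : Fin d → ℕ, i ∈ IK ↔ ∑ j, i j ≤ K)
    (s : ℝ) (hs : 1 ≤ s)
    (Δ : Finset (Fin d → ℕ)) (hne : Δ.Nonempty) (hssub : Δ ⊂ IK)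
    (hcard : (Δ.card : ℝ) ≤ s) :
    (∑ i ∈ Δ, u i ^ 2) +
        ((IK \ Δ).sup' (Finset.sdiff_nonempty.mpr hssub.not_subset)
            fun i => u i ^ 2) * max (Δ.card : ℝ) 1 ≤
      2 * 3 ^ K * s := by
  have hbound : ∀ i ∈ IK, u i ^ 2 ≤ 3 ^ K := fun i hi => by
    rw [hu]
    exact prod_sqrt_two_mul_add_one_sq_le ((hIK i).1 hi)
  have hsum : ∑ i ∈ Δ, u i ^ 2 ≤ 3 ^ K * s := by
    calc ∑ i ∈ Δ, u i ^ 2 ≤ Δ.card • (3 : ℝ) ^ K :=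
          Finset.sum_le_card_nsmul _ _ _ fun i hi => hbound i (hssub.subset hi)
      _ = 3 ^ K * (Δ.card : ℝ) := by rw [nsmul_eq_mul, mul_comm]
      _ ≤ 3 ^ K * s := by gcongr
  have hmax : ((IK \ Δ).sup' (Finset.sdiff_nonempty.mpr hssub.not_subset)
      fun i => u i ^ 2) * max (Δ.card : ℝ) 1 ≤ 3 ^ K * s :=
    mul_le_mul (Finset.sup'_le _ _ fun i hi => hbound i (Finset.mem_sdiff.1 hi).1)
      (max_le hcard hs) (by positivity) (by positivity)
  linarith
end

section
/- Let d ∈ ℕ and define u : ℕ₀^d → ℝ by u_i := Π_{j=1}^d √(2 i_j + 1). Then for every s ≥ 1, every nonempty finite lower set Δ ⊆ ℕ₀^d with |Δ| ≤ s, and every finite set I_K ⊆ ℕ₀^d with Δ ⊊ I_K, one has M(Δ; u, u) = |Δ|_u + max{|Δ|_u, 1} ≤ 2·s². In particular, Σ_{i∈Δ} Π_{j=1}^d (2 i_j + 1) ≤ |Δ|² for every nonempty finite lower set Δ. -/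
open scoped BigOperators

/-- The pairs of natural numbers with maximum `n`. -/
def maxAntidiagonal (n : ℕ) : Finset (ℕ × ℕ) :=
  (Finset.range (n + 1) ×ˢ Finset.range (n + 1)) \ (Finset.range n ×ˢ Finset.range n)

theorem mem_maxAntidiagonal {n : ℕ} {p : ℕ × ℕ} :
    p ∈ maxAntidiagonal n ↔ max p.1 p.2 = n := by
  simp only [maxAntidiagonal, Finset.mem_sdiff, Finset.mem_product, Finset.mem_range]
  omega

theorem card_maxAntidiagonal (n : ℕ) : (maxAntidiagonal n).card = 2 * n + 1 := by
  rw [maxAntidiagonal, Finset.card_sdiff_of_subset]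
  · simp only [Finset.card_product, Finset.card_range]
    have : (n + 1) * (n + 1) = n * n + (2 * n + 1) := by ring
    omega
  · intro p
    simp only [Finset.mem_product, Finset.mem_range]
    omega

/-- For a lower set `Δ`, each pair of multi-indices with supremum `i ∈ Δ` lies in `Δ × Δ`, and
there are `∏ j, (2 * i j + 1)` such pairs. -/
theorem IsLowerIndexSet.sum_prod_le_card_sq {d : ℕ} {Δ : Finset (Fin d → ℕ)}
    (h : IsLowerIndexSet Δ) : ∑ i ∈ Δ, ∏ j, (2 * i j + 1) ≤ Δ.card ^ 2 := by
  have hc : ∑ i ∈ Δ, ∏ j, (2 * i j + 1) =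
      (Δ.sigma fun i => Fintype.piFinset fun j => maxAntidiagonal (i j)).card := by
    simp [Finset.card_sigma, Fintype.card_piFinset, card_maxAntidiagonal]
  rw [hc, sq, ← Finset.card_product]
  refine Finset.card_le_card_of_injOn
    (fun x => (fun j => (x.2 j).1, fun j => (x.2 j).2)) ?_ ?_
  · rintro ⟨i, f⟩ hx
    simp only [Finset.mem_coe, Finset.mem_sigma, Fintype.mem_piFinset,
      mem_maxAntidiagonal] at hx
    simp only [Finset.mem_coe, Finset.mem_product]
    exact ⟨h i hx.1 _ fun j => hx.2 j ▸ le_max_left _ _,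
      h i hx.1 _ fun j => hx.2 j ▸ le_max_right _ _⟩
  · rintro ⟨i, f⟩ hx ⟨i', f'⟩ hx' hff
    simp only [Finset.mem_coe, Finset.mem_sigma, Fintype.mem_piFinset,
      mem_maxAntidiagonal] at hx hx'
    simp only [Prod.mk.injEq] at hff
    obtain rfl : f = f' := funext fun j => Prod.ext (congrFun hff.1 j) (congrFun hff.2 j)
    obtain rfl : i = i' := funext fun j => (hx.2 j).symm.trans (hx'.2 j)
    rfl

/-- Tensor Legendre polynomials with uniform sampling, weighted case `w = u` with
`u_i = Π_j √(2 i_j + 1)`: for every nonempty finite lower set `Δ` with `|Δ| ≤ s` and any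
finite `I_K ⊋ Δ`, one has `M(Δ;u,u) = |Δ|_u + max{|Δ|_u,1} ≤ 2 s²`; in particular
`Σ_{i∈Δ} Π_j (2 i_j + 1) ≤ |Δ|²`. -/
theorem stmt9 (d : ℕ) (u : (Fin d → ℕ) → ℝ)
    (hu : ∀ i, u i = ∏ j, Real.sqrt (2 * (i j : ℝ) + 1))
    (s : ℝ) (hs : 1 ≤ s)
    (Δ : Finset (Fin d → ℕ)) (hne : Δ.Nonempty) (hlow : IsLowerIndexSet Δ)
    (hcard : (Δ.card : ℝ) ≤ s)
    (IK : Finset (Fin d → ℕ)) (hssub : Δ ⊂ IK) :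
    ((∑ i ∈ Δ, u i ^ 2) +
        ((IK \ Δ).sup' (Finset.sdiff_nonempty.mpr hssub.not_subset)
            fun i => u i ^ 2 / u i ^ 2) * max (∑ i ∈ Δ, u i ^ 2) 1 =
      (∑ i ∈ Δ, u i ^ 2) + max (∑ i ∈ Δ, u i ^ 2) 1) ∧
    (∑ i ∈ Δ, u i ^ 2) + max (∑ i ∈ Δ, u i ^ 2) 1 ≤ 2 * s ^ 2 ∧
    ∑ i ∈ Δ, (∏ j, (2 * (i j : ℝ) + 1)) ≤ (Δ.card : ℝ) ^ 2 := by
  have hsq (i : Fin d → ℕ) : u i ^ 2 = ∏ j, (2 * (i j : ℝ) + 1) := by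
    rw [hu, ← Finset.prod_pow]
    exact Finset.prod_congr rfl fun j _ => Real.sq_sqrt (by positivity)
  have hpos (i : Fin d → ℕ) : u i ^ 2 ≠ 0 := by
    rw [hsq]
    positivity
  have hmain : ∑ i ∈ Δ, (∏ j, (2 * (i j : ℝ) + 1)) ≤ (Δ.card : ℝ) ^ 2 := by
    exact_mod_cast hlow.sum_prod_le_card_sq
  have hle : ∑ i ∈ Δ, u i ^ 2 ≤ s ^ 2 := by
    simp only [hsq]
    exact hmain.trans (by gcongr)
  refine ⟨?_, ?_, hmain⟩
  · simp only [div_self (hpos _), Finset.sup'_const, one_mul]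
  · have hmax : max (∑ i ∈ Δ, u i ^ 2) 1 ≤ s ^ 2 := max_le hle (one_le_pow₀ hs)
    linarith
end

section
/- Let β := log(1 + 4/π)/log 2. Then for every n ≥ 0 and all real numbers a₀ ≥ a₁ ≥ … ≥ a_n > 0, one has (a₀ + a₁ + … + a_n)^β ≥ a₀^β + (4/π)·(a₁^β + … + a_n^β). -/
open scoped BigOperators

theorem Real.two_rpow_log_div_log_two {c : ℝ} (hc : 0 < c) :
    (2 : ℝ) ^ (Real.log c / Real.log 2) = c := by
  rw [Real.rpow_def_of_pos two_pos, mul_div_cancel₀ _ (Real.log_pos one_lt_two).ne',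
    Real.exp_log hc]

/-- Superadditivity of `x ↦ x ^ β` with the sharp constant `2 ^ β - 1` on the smaller term. -/
theorem Real.rpow_add_two_rpow_sub_one_mul_rpow_le {β s x : ℝ} (hβ : 1 ≤ β) (hx : 0 < x)
    (hxs : x ≤ s) : s ^ β + (2 ^ β - 1) * x ^ β ≤ (s + x) ^ β := by
  have hs : 0 < s := hx.trans_le hxs
  have ht0 : 0 ≤ x / s := by positivity
  have ht1 : 0 ≤ 1 - x / s := sub_nonneg.2 ((div_le_one hs).2 hxs)
  have hconv := (convexOn_rpow hβ).2
  have hx' : x ∈ Set.Ici (0 : ℝ) := hx.le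
  have hsx : s + x ∈ Set.Ici (0 : ℝ) := (add_pos hs hx).le
  have h1 := hconv hx' hsx ht1 ht0 (by ring)
  have h2 := hconv hx' hsx ht0 ht1 (by ring)
  simp only [smul_eq_mul] at h1 h2
  rw [show (1 - x / s) * x + x / s * (s + x) = 2 * x by field_simp; ring,
    Real.mul_rpow two_pos.le hx.le] at h1
  rw [show x / s * x + (1 - x / s) * (s + x) = s by field_simp; ring] at h2
  linarith

/-- For `β = log(1+4/π)/log 2` and reals `a₀ ≥ a₁ ≥ … ≥ a_n > 0`,
`(a₀ + … + a_n)^β ≥ a₀^β + (4/π)·(a₁^β + … + a_n^β)`. -/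
theorem stmt12 (β : ℝ) (hβ : β = Real.log (1 + 4 / Real.pi) / Real.log 2)
    (n : ℕ) (a : ℕ → ℝ) (hpos : ∀ i ≤ n, 0 < a i)
    (hmono : ∀ i j : ℕ, i ≤ j → j ≤ n → a j ≤ a i) :
    a 0 ^ β + (4 / Real.pi) * ∑ i ∈ Finset.Icc 1 n, a i ^ β ≤
      (∑ i ∈ Finset.range (n + 1), a i) ^ β := by
  have hpi : 1 ≤ 4 / Real.pi := (one_le_div Real.pi_pos).2 Real.pi_le_four
  have hβ1 : 1 ≤ β := by
    rw [hβ, one_le_div (Real.log_pos one_lt_two)]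
    exact Real.log_le_log two_pos (by linarith)
  have h2β : (2 : ℝ) ^ β - 1 = 4 / Real.pi := by
    rw [hβ, Real.two_rpow_log_div_log_two (by linarith)]
    ring
  induction n with
  | zero => simp
  | succ n ih =>
    have ih := ih (fun i hi => hpos i (by omega)) (fun i j hij hj => hmono i j hij (by omega))
    have hle : a (n + 1) ≤ ∑ i ∈ Finset.range (n + 1), a i :=
      (hmono 0 (n + 1) (by omega) le_rfl).trans <|
        Finset.single_le_sum (f := a)
          (fun i hi => (hpos i (Finset.mem_range.1 hi).le).le) (by simp)
    have hstep := Real.rpow_add_two_rpow_sub_one_mul_rpow_le hβ1 (hpos (n + 1) le_rfl) hle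
    rw [h2β] at hstep
    rw [Finset.sum_range_succ _ (n + 1), Finset.sum_Icc_succ_top (by omega), mul_add]
    linarith
end

section
/- Let I be an index set, I_K ⊆ I a finite subset, and Δ, Γ ⊆ I_K nonempty finite sets with Δ ∪ Γ ⊊ I_K and s := |Δ|. Let 0 < γ < 1 and define weights w by w_i² = γ for i ∈ Γ and w_i = 1 for i ∉ Γ, and set ρ := |Δ ∩ Γ|/|Γ| and σ := |Γ|/|Δ|. Take u_i = 1 for all i, and assume |Δ ∪ Γ|_w ≥ 1. Then M(Δ; 1, 1) = 2s and M(Δ ∪ Γ; 1, w) = (2 + σ(1 + γ − 2ρ))·s. In particular, if ρ > (1+γ)/2, then M(Δ ∪ Γ; 1, w) < M(Δ; 1, 1). -/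
open scoped BigOperators

/-- Support estimation via weighted ℓ¹ minimization: with `u ≡ 1`, weights `w` equal to `√γ` on
the estimated support `Γ` and `1` elsewhere, `ρ = |Δ∩Γ|/|Γ|`, `σ = |Γ|/|Δ|`, one has
`M(Δ;1,1) = 2s` and `M(Δ∪Γ;1,w) = (2 + σ(1+γ−2ρ))·s`; in particular if `ρ > (1+γ)/2` then
`M(Δ∪Γ;1,w) < M(Δ;1,1)`. -/
theorem stmt13 {I : Type*} [DecidableEq I] (IK Δ Γ : Finset I)
    (hΔne : Δ.Nonempty) (hΓne : Γ.Nonempty) (hΔK : Δ ⊆ IK) (hΓK : Γ ⊆ IK)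
    (hss : Δ ∪ Γ ⊂ IK) (s : ℝ) (hs : s = Δ.card)
    (γ : ℝ) (hγ0 : 0 < γ) (hγ1 : γ < 1)
    (w : I → ℝ) (hwΓ : ∀ i ∈ Γ, w i ^ 2 = γ) (hwΓc : ∀ i ∉ Γ, w i = 1)
    (ρ σ : ℝ) (hρ : ρ = (Δ ∩ Γ).card / Γ.card) (hσ : σ = (Γ.card : ℝ) / Δ.card)
    (hw1 : 1 ≤ ∑ i ∈ Δ ∪ Γ, w i ^ 2) :
    ((Δ.card : ℝ) +
        ((IK \ Δ).sup'
            (Finset.sdiff_nonempty.mpr fun h => hss.not_subset (h.trans Finset.subset_union_left))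
            fun _ => (1 : ℝ)) * max (Δ.card : ℝ) 1 = 2 * s) ∧
    (((Δ ∪ Γ).card : ℝ) +
        ((IK \ (Δ ∪ Γ)).sup' (Finset.sdiff_nonempty.mpr hss.not_subset)
            fun i => 1 / w i ^ 2) * max (∑ i ∈ Δ ∪ Γ, w i ^ 2) 1 =
      (2 + σ * (1 + γ - 2 * ρ)) * s) ∧
    (ρ > (1 + γ) / 2 →
      ((Δ ∪ Γ).card : ℝ) +
          ((IK \ (Δ ∪ Γ)).sup' (Finset.sdiff_nonempty.mpr hss.not_subset)
              fun i => 1 / w i ^ 2) * max (∑ i ∈ Δ ∪ Γ, w i ^ 2) 1 <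
        (Δ.card : ℝ) +
          ((IK \ Δ).sup'
              (Finset.sdiff_nonempty.mpr fun h => hss.not_subset (h.trans Finset.subset_union_left))
              fun _ => (1 : ℝ)) * max (Δ.card : ℝ) 1) := by
  have hd : (1 : ℝ) ≤ Δ.card := by exact_mod_cast hΔne.card_pos
  have hg : (0 : ℝ) < Γ.card := by exact_mod_cast hΓne.card_pos
  have hunion : ((Δ ∪ Γ).card : ℝ) + (Δ ∩ Γ).card = Δ.card + Γ.card := by
    exact_mod_cast Finset.card_union_add_card_inter Δ Γ
  have hsdiff : ((Δ \ Γ).card : ℝ) + (Δ ∩ Γ).card = Δ.card := by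
    exact_mod_cast Finset.card_sdiff_add_card_inter Δ Γ
  have hsum : ∑ i ∈ Δ ∪ Γ, w i ^ 2 = (Δ \ Γ).card + Γ.card * γ := by
    rw [← Finset.sdiff_union_self_eq_union, Finset.sum_union Finset.sdiff_disjoint,
      Finset.sum_congr rfl hwΓ,
      Finset.sum_congr rfl fun i hi => by rw [hwΓc i (Finset.mem_sdiff.mp hi).2, one_pow]]
    simp
  have hsup : ((IK \ (Δ ∪ Γ)).sup' (Finset.sdiff_nonempty.mpr hss.not_subset)
      fun i => 1 / w i ^ 2) = 1 := by
    rw [Finset.sup'_congr _ rfl (g := fun _ => (1 : ℝ)), Finset.sup'_const]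
    intro i hi
    have hiΓ : i ∉ Γ := fun h =>
      (Finset.mem_sdiff.mp hi).2 (Finset.mem_union_right Δ h)
    simp [hwΓc i hiΓ]
  have hunweighted : (Δ.card : ℝ) +
      ((IK \ Δ).sup'
          (Finset.sdiff_nonempty.mpr fun h => hss.not_subset (h.trans Finset.subset_union_left))
          fun _ => (1 : ℝ)) * max (Δ.card : ℝ) 1 = 2 * s := by
    rw [Finset.sup'_const, max_eq_left hd, hs]
    ring
  have hweighted : ((Δ ∪ Γ).card : ℝ) +
      ((IK \ (Δ ∪ Γ)).sup' (Finset.sdiff_nonempty.mpr hss.not_subset)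
          fun i => 1 / w i ^ 2) * max (∑ i ∈ Δ ∪ Γ, w i ^ 2) 1 =
        (2 + σ * (1 + γ - 2 * ρ)) * s := by
    have hd0 : (Δ.card : ℝ) ≠ 0 := by positivity
    rw [hsup, max_eq_left hw1, hsum, hs, hσ, hρ]
    field_simp
    linear_combination hunion + hsdiff
  refine ⟨hunweighted, hweighted, fun h => ?_⟩
  rw [hunweighted, hweighted]
  have hs0 : 0 < s := by linarith
  have hσ0 : 0 < σ := by rw [hσ]; positivity
  have hneg : σ * (1 + γ - 2 * ρ) < 0 := mul_neg_of_pos_of_neg hσ0 (by linarith)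
  gcongr
  linarith
end
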